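/- arXiv:2509.17882 — 11 statements merged into one kernel-verified Lean document; each statement's English description precedes it below -/
import Mathlib

section
/- The set F_D of all integer solutions (x, y) ∈ ℤ² of the Pell equation x² − D·y² = 1 equals the union, over all sign choices i, j ∈ {1, −1}, of the sets {(i·u_n, j·v_n) : n ∈ ℤ, n ≥ 0}, where (u_n, v_n) are the integer pairs determined by u_n + v_n·√D = (α + β·√D)^n for each integer n ≥ 0. -/
open Pell in
/-- A positive solution minimizing `x + y√D` among those exceeding `1` is fundamental. -/
theorem pell_isFundamental_of_minimal {D : ℤ} (hD : 1 < D) (a : Solution₁ D)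
    (hx : 0 < a.x) (hy : 0 < a.y)
    (hmin : ∀ x y : ℤ, x ^ 2 - D * y ^ 2 = 1 → 1 < (x : ℝ) + (y : ℝ) * Real.sqrt D →
      (a.x : ℝ) + (a.y : ℝ) * Real.sqrt D ≤ (x : ℝ) + (y : ℝ) * Real.sqrt D) :
    IsFundamental a := by
  refine ⟨by nlinarith [a.prop], hy, ?_⟩
  intro b hb
  by_contra! hlt
  have hyy : |b.y| < a.y := by
    apply abs_lt_of_sq_lt_sq _ hy.le
    have h1 := a.prop_y
    have h2 := b.prop_y
    have h3 : b.x ^ 2 < a.x ^ 2 := by nlinarith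
    exact lt_of_mul_lt_mul_left (by linarith : D * b.y ^ 2 < D * a.y ^ 2) (by linarith)
  have hs : 0 ≤ Real.sqrt D := Real.sqrt_nonneg _
  have hb' : (1 : ℝ) < b.x := by exact_mod_cast hb
  have h0 : (0 : ℝ) ≤ (|b.y| : ℤ) := by exact_mod_cast abs_nonneg b.y
  have h := hmin b.x |b.y| (by rw [sq_abs]; exact b.prop) (by nlinarith [mul_nonneg h0 hs])
  have hxr : (b.x : ℝ) < a.x := by exact_mod_cast hlt
  have hyr : ((|b.y| : ℤ) : ℝ) ≤ a.y := by exact_mod_cast hyy.le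
  nlinarith [mul_le_mul_of_nonneg_right hyr hs]

/-- The integer coordinates of `(α + β√D) ^ n` are those of the `n`-th power of the solution. -/
theorem pell_coords_pow {D : ℤ} (hD : 0 ≤ D) (hDns : ¬ IsSquare D) (a : Pell.Solution₁ D)
    (n : ℕ) {u v : ℤ}
    (h : (u : ℝ) + (v : ℝ) * Real.sqrt D = ((a.x : ℝ) + (a.y : ℝ) * Real.sqrt D) ^ n) :
    (a ^ n).x = u ∧ (a ^ n).y = v := by
  have key : (⟨u, v⟩ : ℤ√D) = ((a ^ n : Pell.Solution₁ D) : ℤ√D) := by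
    apply Zsqrtd.toReal_injective hD fun m hm => hDns ⟨m, hm⟩
    exact h.trans (map_pow (Zsqrtd.toReal hD) (a : ℤ√D) n).symm
  exact ⟨(congrArg Zsqrtd.re key).symm, (congrArg Zsqrtd.im key).symm⟩

theorem stmt0 (D : ℤ) (hD : 1 < D) (hDns : ¬ IsSquare D)
    (α β : ℤ) (hα : 0 < α) (hβ : 0 < β)
    (hsol : α ^ 2 - D * β ^ 2 = 1)
    (hmin : ∀ x y : ℤ, x ^ 2 - D * y ^ 2 = 1 →
      1 < (x : ℝ) + (y : ℝ) * Real.sqrt D →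
      (α : ℝ) + (β : ℝ) * Real.sqrt D ≤ (x : ℝ) + (y : ℝ) * Real.sqrt D)
    (U V : ℕ → ℤ)
    (hUV : ∀ n : ℕ, ((U n : ℝ) + (V n : ℝ) * Real.sqrt D)
      = ((α : ℝ) + (β : ℝ) * Real.sqrt D) ^ n) :
    {p : ℤ × ℤ | p.1 ^ 2 - D * p.2 ^ 2 = 1} =
      ⋃ i ∈ ({1, -1} : Set ℤ), ⋃ j ∈ ({1, -1} : Set ℤ),
        {p : ℤ × ℤ | ∃ n : ℕ, p.1 = i * U n ∧ p.2 = j * V n} := by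
  have hf := pell_isFundamental_of_minimal hD (Pell.Solution₁.mk α β hsol) hα hβ hmin
  have hpow : ∀ n, (Pell.Solution₁.mk α β hsol ^ n).x = U n ∧
      (Pell.Solution₁.mk α β hsol ^ n).y = V n :=
    fun n => pell_coords_pow (by linarith) hDns _ n (hUV n)
  generalize Pell.Solution₁.mk α β hsol = a at hf hpow
  ext ⟨x, y⟩
  simp only [Set.mem_iUnion, Set.mem_ofPred_eq, exists_prop]
  constructor
  · intro h
    obtain ⟨b, hbx, hby, hb⟩ := Pell.Solution₁.exists_pos_variant hf.d_pos
      (Pell.Solution₁.mk x y h)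
    obtain ⟨n, rfl⟩ := hf.eq_pow_of_nonneg hbx hby
    obtain ⟨hU, hV⟩ := hpow n
    simp only [Set.mem_insert_iff, Set.mem_singleton_iff] at hb
    have hcoord : ∀ c, Pell.Solution₁.mk x y h = c → x = c.x ∧ y = c.y := by
      rintro c rfl
      exact ⟨rfl, rfl⟩
    rcases hb with hb | hb | hb | hb <;> obtain ⟨hx, hy⟩ := hcoord _ hb <;>
      simp only [Pell.Solution₁.x_neg, Pell.Solution₁.y_neg, Pell.Solution₁.x_inv,
        Pell.Solution₁.y_inv, hU, hV, neg_neg] at hx hy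
    · exact ⟨1, by simp, 1, by simp, n, by simp [hx], by simp [hy]⟩
    · exact ⟨1, by simp, -1, by simp, n, by simp [hx], by simp [hy]⟩
    · exact ⟨-1, by simp, -1, by simp, n, by simp [hx], by simp [hy]⟩
    · exact ⟨-1, by simp, 1, by simp, n, by simp [hx], by simp [hy]⟩
  · rintro ⟨i, hi, j, hj, n, rfl, rfl⟩
    have hi2 : i ^ 2 = 1 := by rcases hi with rfl | rfl <;> norm_num
    have hj2 : j ^ 2 = 1 := by rcases hj with rfl | rfl <;> norm_num
    rw [mul_pow, mul_pow, hi2, hj2, one_mul, one_mul, ← (hpow n).1, ← (hpow n).2]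
    exact (a ^ n).prop
end

section
/- For any real number λ with 0 < λ < 1, the set Q_{F_D}(λ) is empty; and for any real number λ ≥ 1, Q_{F_D}(λ) = ⋃_{i,j ∈ {1,−1}} {(i·u(n), j·v(n)) : n ∈ ℤ, 0 ≤ n ≤ g(λ)}, where g is the inverse of f = u + v. -/
/-- Powers of a Pell solution, seen as real numbers `x + y * s` with `s ^ 2 = D`. -/
lemma Pell.Solution₁.pow_add_mul {D : ℤ} (a : Pell.Solution₁ D) {s : ℝ} (hs : s ^ 2 = D) (n : ℕ) :
    ((a.x : ℝ) + a.y * s) ^ n = ((a ^ n).x : ℝ) + (a ^ n).y * s := by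
  induction n with
  | zero => simp
  | succ k ih =>
    rw [pow_succ, ih, pow_succ, Pell.Solution₁.x_mul, Pell.Solution₁.y_mul]
    push_cast
    rw [← hs]
    ring

/-- A positive Pell solution minimizing `x + y * √D` among the solutions where this number exceeds
`1` is fundamental. -/
lemma Pell.isFundamental_of_forall_le {D : ℤ} (hD : 1 < D) (a : Pell.Solution₁ D)
    (hx : 0 < a.x) (hy : 0 < a.y)
    (hmin : ∀ x y : ℤ, x ^ 2 - D * y ^ 2 = 1 → 1 < (x : ℝ) + (y : ℝ) * Real.sqrt D →
      (a.x : ℝ) + (a.y : ℝ) * Real.sqrt D ≤ (x : ℝ) + (y : ℝ) * Real.sqrt D) :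
    Pell.IsFundamental a := by
  have hs : 0 < Real.sqrt D := Real.sqrt_pos.mpr (by exact_mod_cast (by lia : 0 < D))
  refine ⟨?_, hy, fun {b} hb => ?_⟩
  · have := a.prop
    nlinarith [mul_pos hy hy]
  · by_contra! hlt
    have hb' : b.x ^ 2 - D * |b.y| ^ 2 = 1 := by rw [sq_abs]; exact b.prop
    have hylt : |b.y| < a.y := by
      refine lt_of_pow_lt_pow_left₀ 2 hy.le ?_
      have h1 := a.prop
      have h2 : b.x ^ 2 < a.x ^ 2 := by nlinarith
      nlinarith
    have hbx : (1 : ℝ) < b.x := by exact_mod_cast hb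
    have h0 : (0 : ℝ) ≤ (|b.y| : ℤ) := by exact_mod_cast abs_nonneg b.y
    have h := hmin b.x |b.y| hb' (by nlinarith [mul_nonneg h0 hs.le])
    have h1 : (b.x : ℝ) < a.x := by exact_mod_cast hlt
    have h2 : ((|b.y| : ℤ) : ℝ) < a.y := by exact_mod_cast hylt
    linarith [mul_lt_mul_of_pos_right h2 hs]

lemma mul_rpow_add_mul_inv_rpow_lt {E A B : ℝ} (hE : 1 < E) (hB : 0 ≤ B) (hAB : B < A) {x y : ℝ}
    (hx : 0 ≤ x) (hxy : x < y) :
    A * E ^ x + B * (E ^ x)⁻¹ < A * E ^ y + B * (E ^ y)⁻¹ := by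
  have h1 : 1 ≤ E ^ x := Real.one_le_rpow hE.le hx
  have h2 : E ^ x < E ^ y := Real.rpow_lt_rpow_of_exponent_lt hE hxy
  generalize E ^ x = p at *
  generalize E ^ y = q at *
  have hp : 0 < p := by linarith
  have hq : 0 < q := by linarith
  have h : A * q + B * q⁻¹ - (A * p + B * p⁻¹) = (q - p) * (A - B * (p * q)⁻¹) := by
    field_simp
    ring
  have h3 : (p * q)⁻¹ ≤ 1 := inv_le_one_of_one_le₀ (by nlinarith)
  have h4 : 0 < (q - p) * (A - B * (p * q)⁻¹) := mul_pos (by linarith) (by nlinarith)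
  linarith

lemma exists_unit_mul_abs (x : ℤ) : ∃ i ∈ ({1, -1} : Set ℝ), (x : ℝ) = i * |(x : ℝ)| := by
  rcases abs_choice (x : ℝ) with h | h
  · exact ⟨1, by simp, by rw [h]; ring⟩
  · exact ⟨-1, by simp, by rw [h]; ring⟩


theorem stmt3 (D : ℤ) (hD : 1 < D) (hDns : ¬ IsSquare D)
    (α β : ℤ) (hα : 0 < α) (hβ : 0 < β)
    (hsol : α ^ 2 - D * β ^ 2 = 1)
    (hmin : ∀ x y : ℤ, x ^ 2 - D * y ^ 2 = 1 →
      1 < (x : ℝ) + (y : ℝ) * Real.sqrt D →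
      (α : ℝ) + (β : ℝ) * Real.sqrt D ≤ (x : ℝ) + (y : ℝ) * Real.sqrt D)
    (u v : ℝ → ℝ)
    (hu : ∀ x : ℝ, 0 ≤ x →
      u x = (((α : ℝ) + (β : ℝ) * Real.sqrt D) ^ x
        + ((α : ℝ) - (β : ℝ) * Real.sqrt D) ^ x) / 2)
    (hv : ∀ x : ℝ, 0 ≤ x →
      v x = (((α : ℝ) + (β : ℝ) * Real.sqrt D) ^ x
        - ((α : ℝ) - (β : ℝ) * Real.sqrt D) ^ x) / (2 * Real.sqrt D))
    (g : ℝ → ℝ)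
    (hg0 : ∀ y : ℝ, 1 ≤ y → 0 ≤ g y)
    (hgf : ∀ x : ℝ, 0 ≤ x → g (u x + v x) = x)
    (hfg : ∀ y : ℝ, 1 ≤ y → u (g y) + v (g y) = y) :
    (∀ lam : ℝ, 0 < lam → lam < 1 →
      {p : ℤ × ℤ | p.1 ^ 2 - D * p.2 ^ 2 = 1 ∧ |(p.1 : ℝ)| + |(p.2 : ℝ)| ≤ lam} = ∅) ∧
    (∀ lam : ℝ, 1 ≤ lam →
      {p : ℤ × ℤ | p.1 ^ 2 - D * p.2 ^ 2 = 1 ∧ |(p.1 : ℝ)| + |(p.2 : ℝ)| ≤ lam} =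
        ⋃ i ∈ ({1, -1} : Set ℝ), ⋃ j ∈ ({1, -1} : Set ℝ),
          {p : ℤ × ℤ | ∃ n : ℕ, (n : ℝ) ≤ g lam ∧
            (p.1 : ℝ) = i * u n ∧ (p.2 : ℝ) = j * v n}) := by
  have hDpos : 0 < D := by lia
  have hD1 : (1 : ℝ) < D := by exact_mod_cast hD
  have hs : 1 < Real.sqrt D := by rw [Real.lt_sqrt zero_le_one]; simpa using hD1
  have hs2 : Real.sqrt D ^ 2 = D := Real.sq_sqrt (by linarith)
  let a : Pell.Solution₁ D := Pell.Solution₁.mk α β hsol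
  have ha : Pell.IsFundamental a := Pell.isFundamental_of_forall_le hD a hα hβ hmin
  have hpow := fun n : ℕ => a.pow_add_mul hs2 n
  have hpow' := fun n : ℕ => a.pow_add_mul (s := -Real.sqrt D) (by rw [neg_sq, hs2]) n
  simp only [a, Pell.Solution₁.x_mk, Pell.Solution₁.y_mk, mul_neg, ← sub_eq_add_neg]
    at hpow hpow'
  have hun : ∀ n : ℕ, u n = (a ^ n).x := fun n => by
    rw [hu n n.cast_nonneg, Real.rpow_natCast, Real.rpow_natCast, hpow, hpow']
    ring
  have hvn : ∀ n : ℕ, v n = (a ^ n).y := fun n => by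
    rw [hv n n.cast_nonneg, Real.rpow_natCast, Real.rpow_natCast, hpow, hpow']
    field_simp
    ring
  have hax : ∀ n : ℕ, 0 ≤ (a ^ n).x := fun n => (Pell.Solution₁.x_pow_pos (a := a) hα n).le
  have hay : ∀ n : ℕ, 0 ≤ (a ^ n).y := fun n => by
    cases n with
    | zero => simp
    | succ k => exact (Pell.Solution₁.y_pow_succ_pos (a := a) hα hβ k).le
  have hE : 1 < (α : ℝ) + β * Real.sqrt D := by
    have h1 : (1 : ℝ) ≤ α := by exact_mod_cast hα
    have h2 : (1 : ℝ) ≤ β := by exact_mod_cast hβ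
    nlinarith
  have hconj : (α : ℝ) - β * Real.sqrt D = ((α : ℝ) + β * Real.sqrt D)⁻¹ := by
    refine eq_inv_of_mul_eq_one_left ?_
    have h : (α : ℝ) ^ 2 - D * β ^ 2 = 1 := by exact_mod_cast hsol
    rw [← hs2] at h
    linarith
  have hmono : StrictMonoOn (fun x => u x + v x) (Set.Ici 0) := by
    intro x hx y hy hxy
    have hf : ∀ z : ℝ, 0 ≤ z → u z + v z =
        (1 / 2 + 1 / (2 * Real.sqrt D)) * ((α : ℝ) + β * Real.sqrt D) ^ z +
        (1 / 2 - 1 / (2 * Real.sqrt D)) * (((α : ℝ) + β * Real.sqrt D) ^ z)⁻¹ := fun z hz => by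
      rw [hu z hz, hv z hz, hconj, Real.inv_rpow (by linarith)]
      ring
    have hpos : 0 < 1 / (2 * Real.sqrt D) := by positivity
    have hle : 1 / (2 * Real.sqrt D) ≤ 1 / 2 :=
      one_div_le_one_div_of_le two_pos (by linarith)
    simp only [hf x hx, hf y hy]
    exact mul_rpow_add_mul_inv_rpow_lt hE (by linarith) (by linarith) hx hxy
  have hle : ∀ lam : ℝ, 1 ≤ lam → ∀ n : ℕ,
      ((n : ℝ) ≤ g lam ↔ ((a ^ n).x : ℝ) + (a ^ n).y ≤ lam) := fun lam hlam n => by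
    rw [← hun, ← hvn]
    conv_rhs => rw [← hfg lam hlam]
    exact (hmono.le_iff_le (Set.mem_Ici.mpr n.cast_nonneg) (hg0 lam hlam)).symm
  constructor
  · intro lam _ hlam
    refine Set.eq_empty_of_forall_notMem ?_
    rintro ⟨x, y⟩ ⟨hxy, hsum⟩
    simp only at hxy hsum
    have hx : x ≠ 0 := (Pell.Solution₁.mk x y hxy).x_ne_zero hDpos.le
    have h1 : (1 : ℝ) ≤ |(x : ℝ)| := by exact_mod_cast Int.one_le_abs hx
    linarith [abs_nonneg (y : ℝ)]
  · intro lam hlam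
    ext ⟨x, y⟩
    simp only [Set.mem_ofPred_eq, Set.mem_iUnion, exists_prop]
    constructor
    · rintro ⟨hxy, hsum⟩
      have hx : x ≠ 0 := (Pell.Solution₁.mk x y hxy).x_ne_zero hDpos.le
      obtain ⟨n, hn⟩ := ha.eq_pow_of_nonneg
        (a := Pell.Solution₁.mk |x| |y| (by rwa [sq_abs, sq_abs]))
        (abs_pos.mpr hx) (abs_nonneg y)
      have hnx : (a ^ n).x = |x| := by rw [← hn, Pell.Solution₁.x_mk]
      have hny : (a ^ n).y = |y| := by rw [← hn, Pell.Solution₁.y_mk]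
      obtain ⟨i, hi, hxi⟩ := exists_unit_mul_abs x
      obtain ⟨j, hj, hyj⟩ := exists_unit_mul_abs y
      refine ⟨i, hi, j, hj, n, ?_, ?_, ?_⟩
      · rw [hle lam hlam, hnx, hny]
        exact_mod_cast hsum
      · rw [hun, hnx, Int.cast_abs]
        exact hxi
      · rw [hvn, hny, Int.cast_abs]
        exact hyj
    · rintro ⟨i, hi, j, hj, n, hn, hx, hy⟩
      rw [hle lam hlam] at hn
      rw [hun] at hx
      rw [hvn] at hy
      have hi1 : |i| = 1 := by rcases hi with rfl | rfl <;> simp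
      have hj1 : |j| = 1 := by rcases hj with rfl | rfl <;> simp
      have hxn : |(x : ℝ)| = (a ^ n).x := by
        rw [hx, abs_mul, hi1, one_mul, abs_of_nonneg (by exact_mod_cast hax n)]
      have hyn : |(y : ℝ)| = (a ^ n).y := by
        rw [hy, abs_mul, hj1, one_mul, abs_of_nonneg (by exact_mod_cast hay n)]
      refine ⟨?_, by rwa [hxn, hyn]⟩
      have hxn' : |x| = (a ^ n).x := by exact_mod_cast hxn
      have hyn' : |y| = (a ^ n).y := by exact_mod_cast hyn
      rw [← sq_abs x, ← sq_abs y, hxn', hyn']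
      exact (a ^ n).prop
end

section
/- For any real number λ ≥ 1, the set Q_{F_D}(λ) is finite with exactly 2 + 4·⌊g(λ)⌋ elements, where ⌊·⌋ denotes the floor function and g is the inverse of f = u + v; and for 0 < λ < 1 it has 0 elements. -/
open Pell

namespace Pell.Solution₁

variable {d : ℤ}

/-- The real number `x + y √d` attached to a power is the power of the attached real number. -/
lemma x_pow_add_y_pow_mul_sqrt (hd : 0 ≤ d) (a : Solution₁ d) (n : ℕ) :
    ((a ^ n).x : ℝ) + (a ^ n).y * √(d : ℝ) = ((a.x : ℝ) + a.y * √(d : ℝ)) ^ n := by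
  have hs : √(d : ℝ) * √(d : ℝ) = d := Real.mul_self_sqrt (by exact_mod_cast hd)
  induction n with
  | zero => simp
  | succ n ih =>
    rw [pow_succ, pow_succ, ← ih, x_mul, y_mul]
    push_cast
    linear_combination (-((a ^ n).y : ℝ) * a.y) * hs

lemma x_pow_sub_y_pow_mul_sqrt (hd : 0 ≤ d) (a : Solution₁ d) (n : ℕ) :
    ((a ^ n).x : ℝ) - (a ^ n).y * √(d : ℝ) = ((a.x : ℝ) - a.y * √(d : ℝ)) ^ n := by
  have h := x_pow_add_y_pow_mul_sqrt hd a⁻¹ n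
  rw [inv_pow] at h
  simp only [x_inv, y_inv] at h
  push_cast at h
  linear_combination h

lemma x_pow_eq (hd : 0 ≤ d) (a : Solution₁ d) (n : ℕ) :
    ((a ^ n).x : ℝ) =
      (((a.x : ℝ) + a.y * √(d : ℝ)) ^ n + ((a.x : ℝ) - a.y * √(d : ℝ)) ^ n) / 2 := by
  rw [← x_pow_add_y_pow_mul_sqrt hd, ← x_pow_sub_y_pow_mul_sqrt hd]
  ring

lemma y_pow_eq (hd : 0 < d) (a : Solution₁ d) (n : ℕ) :
    ((a ^ n).y : ℝ) =
      (((a.x : ℝ) + a.y * √(d : ℝ)) ^ n - ((a.x : ℝ) - a.y * √(d : ℝ)) ^ n) /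
        (2 * √(d : ℝ)) := by
  have hs : √(d : ℝ) ≠ 0 := (Real.sqrt_pos.2 (by exact_mod_cast hd)).ne'
  rw [← x_pow_add_y_pow_mul_sqrt hd.le, ← x_pow_sub_y_pow_mul_sqrt hd.le]
  field_simp
  ring

lemma y_pow_nonneg {a : Solution₁ d} (hax : 0 < a.x) (hay : 0 < a.y) (n : ℕ) :
    0 ≤ (a ^ n).y := by
  cases n with
  | zero => simp
  | succ n => exact (y_pow_succ_pos hax hay n).le

lemma abs_x_zpow_add_abs_y_zpow {a : Solution₁ d} (hax : 0 < a.x) (hay : 0 < a.y) (n : ℤ) :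
    |(a ^ n).x| + |(a ^ n).y| = (a ^ n.natAbs).x + (a ^ n.natAbs).y := by
  have hx := x_pow_pos hax n.natAbs
  have hy := y_pow_nonneg hax hay n.natAbs
  rcases Int.natAbs_eq n with h | h
  · conv_lhs => rw [h]
    rw [zpow_natCast, abs_of_pos hx, abs_of_nonneg hy]
  · conv_lhs => rw [h]
    rw [zpow_neg, zpow_natCast, x_inv, y_inv, abs_neg, abs_of_pos hx, abs_of_nonneg hy]

end Pell.Solution₁

namespace Pell.IsFundamental

variable {d : ℤ} {a : Solution₁ d}

/-- A positive solution minimizing `x + y √d` is fundamental. -/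
lemma of_forall_le (ha : 0 < a.x) (hy : 0 < a.y) (hd : 0 < d)
    (hmin : ∀ x y : ℤ, x ^ 2 - d * y ^ 2 = 1 → 1 < (x : ℝ) + y * √(d : ℝ) →
      (a.x : ℝ) + a.y * √(d : ℝ) ≤ x + y * √(d : ℝ)) :
    IsFundamental a := by
  have hs : 0 < √(d : ℝ) := Real.sqrt_pos.2 (by exact_mod_cast hd)
  refine ⟨?_, hy, fun {b} hb => ?_⟩
  · have := a.prop
    have := mul_pos hd (pow_pos hy 2)
    nlinarith
  · by_contra! hlt
    have hby : |b.y| < a.y := by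
      rw [← abs_of_pos hy, ← sq_lt_sq]
      refine lt_of_mul_lt_mul_left ?_ hd.le
      rw [b.prop_y, a.prop_y]
      nlinarith
    have hbx : (1 : ℝ) < b.x := by exact_mod_cast hb
    have h := hmin b.x |b.y| (by rw [sq_abs]; exact b.prop) (by
      have : (0 : ℝ) ≤ (|b.y| : ℤ) * √(d : ℝ) := by positivity
      linarith)
    have h1 : (b.x : ℝ) < a.x := by exact_mod_cast hlt
    have h2 : ((|b.y| : ℤ) : ℝ) < a.y := by exact_mod_cast hby
    nlinarith [mul_lt_mul_of_pos_right h2 hs]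

/-- The coordinates of `a ^ n` for `(true, n)` and of `-a ^ n` for `(false, n)`. -/
def signedZPow (a : Solution₁ d) (p : Bool × ℤ) : ℤ × ℤ :=
  if p.1 then ((a ^ p.2).x, (a ^ p.2).y) else ((-a ^ p.2).x, (-a ^ p.2).y)

lemma signedZPow_injective (h : IsFundamental a) : Function.Injective (signedZPow a) := by
  have inj : Function.Injective fun n : ℤ => a ^ n := fun m n hmn =>
    h.y_strictMono.injective (congrArg Solution₁.y hmn)
  rintro ⟨s, m⟩ ⟨t, n⟩ hst
  cases s <;> cases t <;> simp only [signedZPow, if_true, Bool.false_eq_true, if_false,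
    Prod.mk.injEq] at hst <;> have := Solution₁.ext hst.1 hst.2
  · rw [inj (neg_injective this)]
  · exact absurd this.symm h.zpow_ne_neg_zpow
  · exact absurd this h.zpow_ne_neg_zpow
  · rw [inj this]

lemma setOf_eq_image (h : IsFundamental a) {lam : ℝ} {N : ℤ}
    (hN : ∀ n : ℕ, ((a ^ n).x : ℝ) + (a ^ n).y ≤ lam ↔ (n : ℤ) ≤ N) :
    {p : ℤ × ℤ | p.1 ^ 2 - d * p.2 ^ 2 = 1 ∧ |(p.1 : ℝ)| + |(p.2 : ℝ)| ≤ lam} =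
      ↑(((Finset.univ : Finset Bool) ×ˢ Finset.Icc (-N) N).image (signedZPow a)) := by
  have key (n : ℤ) : |((a ^ n).x : ℝ)| + |((a ^ n).y : ℝ)| ≤ lam ↔ -N ≤ n ∧ n ≤ N := by
    have := Solution₁.abs_x_zpow_add_abs_y_zpow h.x_pos h.2.1 n
    rw [← abs_le, ← Int.natCast_natAbs, ← hN]
    have h' : |((a ^ n).x : ℝ)| + |((a ^ n).y : ℝ)| =
        (a ^ n.natAbs).x + (a ^ n.natAbs).y := by exact_mod_cast this
    rw [h']
  ext ⟨x, y⟩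
  simp only [Set.mem_ofPred_eq, Finset.coe_image, Set.mem_image, Finset.mem_coe,
    Finset.mem_product, Finset.mem_univ, true_and, Finset.mem_Icc]
  constructor
  · rintro ⟨hxy, hle⟩
    obtain ⟨n, hn | hn⟩ := h.eq_zpow_or_neg_zpow (Solution₁.mk x y hxy)
    · have hx : (a ^ n).x = x := by rw [← hn, Solution₁.x_mk]
      have hy : (a ^ n).y = y := by rw [← hn, Solution₁.y_mk]
      exact ⟨(true, n), (key n).1 (by rwa [hx, hy]), by simp [signedZPow, hx, hy]⟩
    · have hx : (-a ^ n).x = x := by rw [← hn, Solution₁.x_mk]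
      have hy : (-a ^ n).y = y := by rw [← hn, Solution₁.y_mk]
      refine ⟨(false, n), (key n).1 ?_, by
        simp only [signedZPow, Bool.false_eq_true, if_false, hx, hy]⟩
      rw [← hx, ← hy] at hle
      simpa using hle
  · rintro ⟨⟨s, n⟩, hn, heq⟩
    have hle := (key n).2 hn
    cases s <;> simp only [signedZPow, if_true, Bool.false_eq_true, if_false,
      Prod.mk.injEq] at heq <;> obtain ⟨rfl, rfl⟩ := heq
    · exact ⟨Solution₁.prop _, by simpa using hle⟩
    · exact ⟨Solution₁.prop _, hle⟩

end Pell.IsFundamental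

lemma strictMonoOn_rpow_add_rpow_sub {E E' s : ℝ} (hE : 1 < E) (hEE : E * E' = 1) (hs : 0 < s) :
    StrictMonoOn (fun x : ℝ => (E ^ x + E' ^ x) / 2 + (E ^ x - E' ^ x) / (2 * s))
      (Set.Ici 0) := by
  intro x hx y _ hxy
  have hE0 : 0 < E := one_pos.trans hE
  have hE' : E' = E⁻¹ := eq_inv_of_mul_eq_one_right hEE
  have ha : 1 ≤ E ^ x := Real.one_le_rpow hE.le hx
  have hab : E ^ x < E ^ y := Real.rpow_lt_rpow_of_exponent_lt hE hxy
  simp only [hE', Real.inv_rpow hE0.le]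
  generalize E ^ x = a at *
  generalize E ^ y = b at *
  have hinv : b⁻¹ < a⁻¹ := by gcongr
  have hdiff : a⁻¹ - b⁻¹ ≤ b - a := by
    have h1 : a⁻¹ - b⁻¹ = (b - a) / (a * b) := inv_sub_inv (by positivity) (ha.trans_lt hab |>.trans' one_pos).ne'
    rw [h1]
    exact div_le_self (by linarith) (by nlinarith)
  have h1 : (a - a⁻¹) / (2 * s) < (b - b⁻¹) / (2 * s) := by gcongr
  linarith


theorem stmt4 (D : ℤ) (hD : 1 < D) (hDns : ¬ IsSquare D)
    (α β : ℤ) (hα : 0 < α) (hβ : 0 < β)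
    (hsol : α ^ 2 - D * β ^ 2 = 1)
    (hmin : ∀ x y : ℤ, x ^ 2 - D * y ^ 2 = 1 →
      1 < (x : ℝ) + (y : ℝ) * Real.sqrt D →
      (α : ℝ) + (β : ℝ) * Real.sqrt D ≤ (x : ℝ) + (y : ℝ) * Real.sqrt D)
    (u v : ℝ → ℝ)
    (hu : ∀ x : ℝ, 0 ≤ x →
      u x = (((α : ℝ) + (β : ℝ) * Real.sqrt D) ^ x
        + ((α : ℝ) - (β : ℝ) * Real.sqrt D) ^ x) / 2)
    (hv : ∀ x : ℝ, 0 ≤ x →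
      v x = (((α : ℝ) + (β : ℝ) * Real.sqrt D) ^ x
        - ((α : ℝ) - (β : ℝ) * Real.sqrt D) ^ x) / (2 * Real.sqrt D))
    (g : ℝ → ℝ)
    (hg0 : ∀ y : ℝ, 1 ≤ y → 0 ≤ g y)
    (hgf : ∀ x : ℝ, 0 ≤ x → g (u x + v x) = x)
    (hfg : ∀ y : ℝ, 1 ≤ y → u (g y) + v (g y) = y) :
    (∀ lam : ℝ, 0 < lam → lam < 1 →
      ({p : ℤ × ℤ | p.1 ^ 2 - D * p.2 ^ 2 = 1 ∧ |(p.1 : ℝ)| + |(p.2 : ℝ)| ≤ lam}).Finite ∧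
      ({p : ℤ × ℤ | p.1 ^ 2 - D * p.2 ^ 2 = 1 ∧ |(p.1 : ℝ)| + |(p.2 : ℝ)| ≤ lam}).ncard = 0) ∧
    (∀ lam : ℝ, 1 ≤ lam →
      ({p : ℤ × ℤ | p.1 ^ 2 - D * p.2 ^ 2 = 1 ∧ |(p.1 : ℝ)| + |(p.2 : ℝ)| ≤ lam}).Finite ∧
      (({p : ℤ × ℤ | p.1 ^ 2 - D * p.2 ^ 2 = 1 ∧ |(p.1 : ℝ)| + |(p.2 : ℝ)| ≤ lam}).ncard : ℤ)
        = 2 + 4 * ⌊g lam⌋) := by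
  have hD0 : 0 < D := by linarith
  have hDr : (1 : ℝ) < D := by exact_mod_cast hD
  have hs : 1 < √(D : ℝ) := by rwa [Real.lt_sqrt zero_le_one, one_pow]
  have hss : √(D : ℝ) * √(D : ℝ) = D := Real.mul_self_sqrt (by linarith)
  refine ⟨fun lam _ hlam => ?_, fun lam hlam => ?_⟩
  · have hempty : {p : ℤ × ℤ | p.1 ^ 2 - D * p.2 ^ 2 = 1 ∧
        |(p.1 : ℝ)| + |(p.2 : ℝ)| ≤ lam} = ∅ := by
      refine Set.eq_empty_of_forall_notMem fun p hp => ?_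
      have hx : p.1 ≠ 0 := Solution₁.x_ne_zero hD0.le (Solution₁.mk p.1 p.2 hp.1)
      have hx1 : (1 : ℝ) ≤ |(p.1 : ℝ)| := by exact_mod_cast Int.one_le_abs hx
      linarith [hp.2, abs_nonneg (p.2 : ℝ)]
    simp [hempty]
  · have hfund : IsFundamental (Solution₁.mk α β hsol) :=
      IsFundamental.of_forall_le hα hβ hD0 hmin
    have hEE : ((α : ℝ) + β * √(D : ℝ)) * (α - β * √(D : ℝ)) = 1 := by
      have h : (α : ℝ) ^ 2 - D * β ^ 2 = 1 := by exact_mod_cast hsol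
      linear_combination h - (β : ℝ) ^ 2 * hss
    have hE : 1 < (α : ℝ) + β * √(D : ℝ) := by
      have h1 : (1 : ℝ) ≤ α := by exact_mod_cast hα
      have h2 : (0 : ℝ) < β := by exact_mod_cast hβ
      have : 0 < (β : ℝ) * √(D : ℝ) := by positivity
      linarith
    have hmono : StrictMonoOn (fun x => u x + v x) (Set.Ici 0) :=
      (strictMonoOn_rpow_add_rpow_sub hE hEE (one_pos.trans hs)).congr fun x hx => by
        simp only [hu x hx, hv x hx]
    have hN (n : ℕ) : (((Solution₁.mk α β hsol) ^ n).x : ℝ) + ((Solution₁.mk α β hsol) ^ n).y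
        ≤ lam ↔ (n : ℤ) ≤ ⌊g lam⌋ := by
      have hn : (0 : ℝ) ≤ n := n.cast_nonneg
      have hf : (((Solution₁.mk α β hsol) ^ n).x : ℝ) + ((Solution₁.mk α β hsol) ^ n).y
          = u n + v n := by
        rw [Solution₁.x_pow_eq hD0.le, Solution₁.y_pow_eq hD0, hu n hn, hv n hn]
        simp only [Real.rpow_natCast, Solution₁.x_mk, Solution₁.y_mk]
      rw [hf, Int.le_floor, Int.cast_natCast]
      conv_lhs => rw [← hfg lam hlam]
      exact hmono.le_iff_le hn (hg0 lam hlam)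
    have hg : 0 ≤ ⌊g lam⌋ := Int.floor_nonneg.2 (hg0 lam hlam)
    rw [hfund.setOf_eq_image hN]
    refine ⟨Finset.finite_toSet _, ?_⟩
    rw [Set.ncard_coe_finset, Finset.card_image_of_injective _ hfund.signedZPow_injective,
      Finset.card_product, Finset.card_univ, Fintype.card_bool, Int.card_Icc]
    omega
end

section
/- For any real number x ≥ 1, g(x) = (1/log(α + β√D)) · arcosh( (D·x − √(D·x² − D + 1)) / (D − 1) ), where arcosh is the inverse hyperbolic cosine and g is the inverse of f = u + v. -/
/-- The inverse hyperbolic cosine, `arcosh x = log (x + √(x² - 1))`. -/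
noncomputable def arcosh (x : ℝ) : ℝ := Real.log (x + Real.sqrt (x ^ 2 - 1))

theorem stmt7 (D : ℤ) (hD : 1 < D) (hDns : ¬ IsSquare D)
    (α β : ℤ) (hα : 0 < α) (hβ : 0 < β)
    (hsol : α ^ 2 - D * β ^ 2 = 1)
    (hmin : ∀ x y : ℤ, x ^ 2 - D * y ^ 2 = 1 →
      1 < (x : ℝ) + (y : ℝ) * Real.sqrt D →
      (α : ℝ) + (β : ℝ) * Real.sqrt D ≤ (x : ℝ) + (y : ℝ) * Real.sqrt D)
    (u v : ℝ → ℝ)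
    (hu : ∀ x : ℝ, 0 ≤ x →
      u x = (((α : ℝ) + (β : ℝ) * Real.sqrt D) ^ x
        + ((α : ℝ) - (β : ℝ) * Real.sqrt D) ^ x) / 2)
    (hv : ∀ x : ℝ, 0 ≤ x →
      v x = (((α : ℝ) + (β : ℝ) * Real.sqrt D) ^ x
        - ((α : ℝ) - (β : ℝ) * Real.sqrt D) ^ x) / (2 * Real.sqrt D))
    (g : ℝ → ℝ)
    (hg0 : ∀ y : ℝ, 1 ≤ y → 0 ≤ g y)
    (hgf : ∀ x : ℝ, 0 ≤ x → g (u x + v x) = x)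
    (hfg : ∀ y : ℝ, 1 ≤ y → u (g y) + v (g y) = y) :
    ∀ x : ℝ, 1 ≤ x →
      g x = (1 / Real.log ((α : ℝ) + (β : ℝ) * Real.sqrt D))
        * arcosh (((D : ℝ) * x - Real.sqrt ((D : ℝ) * x ^ 2 - D + 1)) / (D - 1)) := by
  intro x hx
  have hD1 : (1 : ℝ) < (D : ℝ) := by exact_mod_cast hD
  set s := Real.sqrt (D : ℝ) with hs
  have hs0 : 0 < s := Real.sqrt_pos.2 (by linarith)
  have hss : s ^ 2 = (D : ℝ) := Real.sq_sqrt (by linarith)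
  have hα1 : (1 : ℝ) ≤ (α : ℝ) := by exact_mod_cast hα
  have hβ0 : (0 : ℝ) < (β : ℝ) := by exact_mod_cast hβ
  have hsolR : (α : ℝ) ^ 2 - (D : ℝ) * (β : ℝ) ^ 2 = 1 := by exact_mod_cast hsol
  have hε : 1 < (α : ℝ) + (β : ℝ) * s := by
    have := mul_pos hβ0 hs0
    linarith
  have hconj : (α : ℝ) - (β : ℝ) * s = ((α : ℝ) + (β : ℝ) * s)⁻¹ := by
    refine eq_inv_of_mul_eq_one_left ?_
    linear_combination hsolR - (β : ℝ) ^ 2 * hss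
  have ht : 0 ≤ g x := hg0 x hx
  have hsum := hfg x hx
  rw [hu _ ht, hv _ ht, hconj, Real.inv_rpow (by linarith)] at hsum
  have hw1 : 1 ≤ ((α : ℝ) + (β : ℝ) * s) ^ g x := Real.one_le_rpow hε.le ht
  have hlogw : Real.log (((α : ℝ) + (β : ℝ) * s) ^ g x)
      = g x * Real.log ((α : ℝ) + (β : ℝ) * s) := Real.log_rpow (by linarith) _
  have hlog : Real.log ((α : ℝ) + (β : ℝ) * s) ≠ 0 := (Real.log_pos hε).ne'
  generalize ((α : ℝ) + (β : ℝ) * s) ^ g x = w at hsum hw1 hlogw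
  obtain ⟨U, hU⟩ : ∃ U, U = (w + w⁻¹) / 2 := ⟨_, rfl⟩
  obtain ⟨V, hV⟩ : ∃ V, V = (w - w⁻¹) / (2 * s) := ⟨_, rfl⟩
  have hw0 : 0 < w := by linarith
  have hwinv : w⁻¹ ≤ 1 := inv_le_one_of_one_le₀ hw1
  have hU0 : 0 ≤ U := by rw [hU]; positivity
  have hV0 : 0 ≤ V := by rw [hV]; exact div_nonneg (by linarith) (by positivity)
  have hsV : s * V = (w - w⁻¹) / 2 := by rw [hV]; field_simp
  have hpell : U ^ 2 - (D : ℝ) * V ^ 2 = 1 := by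
    have hww : w * w⁻¹ = 1 := mul_inv_cancel₀ hw0.ne'
    calc U ^ 2 - (D : ℝ) * V ^ 2 = U ^ 2 - (s * V) ^ 2 := by rw [← hss]; ring
      _ = w * w⁻¹ := by rw [hsV, hU]; ring
      _ = 1 := hww
  rw [← hU, ← hV] at hsum
  have hsqrt : Real.sqrt ((D : ℝ) * x ^ 2 - D + 1) = U + D * V := by
    rw [show (D : ℝ) * x ^ 2 - D + 1 = (U + D * V) ^ 2 by
      rw [← hsum]; linear_combination ((D : ℝ) - 1) * hpell]
    exact Real.sqrt_sq (by positivity)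
  have harg : ((D : ℝ) * x - Real.sqrt ((D : ℝ) * x ^ 2 - D + 1)) / (D - 1) = U := by
    rw [hsqrt, ← hsum, div_eq_iff (by linarith)]
    ring
  have hsqrtU : Real.sqrt (U ^ 2 - 1) = s * V := by
    rw [show U ^ 2 - 1 = (s * V) ^ 2 by rw [mul_pow, hss]; linarith]
    exact Real.sqrt_sq (by positivity)
  have hUw : U + s * V = w := by rw [hsV, hU]; ring
  rw [harg, arcosh, hsqrtU, hUw, hlogw]
  field_simp
end

section
/- For any real number x ≥ 1, g(x) = [ log( D·x − √(D·x² − D + 1) + √D·√( (D+1)·x² − D + 1 − 2x·√(D·x² − D + 1) ) ) − log(D − 1) ] / log(α + β√D), where g is the inverse of f = u + v. -/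
/-- On the hyperbola `p ^ 2 - d * q ^ 2 = 1`, the value `p + √d * q` in terms of `p + q`. -/
theorem pell_conic_log_argument {d p q : ℝ} (hd : 1 ≤ d) (hp : 0 ≤ p) (hq : 0 ≤ q)
    (h : p ^ 2 - d * q ^ 2 = 1) :
    d * (p + q) - Real.sqrt (d * (p + q) ^ 2 - d + 1)
        + Real.sqrt d * Real.sqrt ((d + 1) * (p + q) ^ 2 - d + 1
          - 2 * (p + q) * Real.sqrt (d * (p + q) ^ 2 - d + 1))
      = (d - 1) * (p + Real.sqrt d * q) := by
  have hS : Real.sqrt (d * (p + q) ^ 2 - d + 1) = p + d * q := by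
    rw [show d * (p + q) ^ 2 - d + 1 = (p + d * q) ^ 2 by linear_combination (d - 1) * h]
    exact Real.sqrt_sq (by positivity)
  have hT : Real.sqrt ((d + 1) * (p + q) ^ 2 - d + 1 - 2 * (p + q) * (p + d * q))
      = (d - 1) * q := by
    rw [show (d + 1) * (p + q) ^ 2 - d + 1 - 2 * (p + q) * (p + d * q) = ((d - 1) * q) ^ 2 by
      linear_combination (d - 1) * h]
    exact Real.sqrt_sq (mul_nonneg (by linarith) hq)
  rw [hS, hT]
  ring

theorem stmt8 (D : ℤ) (hD : 1 < D) (hDns : ¬ IsSquare D)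
    (α β : ℤ) (hα : 0 < α) (hβ : 0 < β)
    (hsol : α ^ 2 - D * β ^ 2 = 1)
    (hmin : ∀ x y : ℤ, x ^ 2 - D * y ^ 2 = 1 →
      1 < (x : ℝ) + (y : ℝ) * Real.sqrt D →
      (α : ℝ) + (β : ℝ) * Real.sqrt D ≤ (x : ℝ) + (y : ℝ) * Real.sqrt D)
    (u v : ℝ → ℝ)
    (hu : ∀ x : ℝ, 0 ≤ x →
      u x = (((α : ℝ) + (β : ℝ) * Real.sqrt D) ^ x
        + ((α : ℝ) - (β : ℝ) * Real.sqrt D) ^ x) / 2)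
    (hv : ∀ x : ℝ, 0 ≤ x →
      v x = (((α : ℝ) + (β : ℝ) * Real.sqrt D) ^ x
        - ((α : ℝ) - (β : ℝ) * Real.sqrt D) ^ x) / (2 * Real.sqrt D))
    (g : ℝ → ℝ)
    (hg0 : ∀ y : ℝ, 1 ≤ y → 0 ≤ g y)
    (hgf : ∀ x : ℝ, 0 ≤ x → g (u x + v x) = x)
    (hfg : ∀ y : ℝ, 1 ≤ y → u (g y) + v (g y) = y) :
    ∀ x : ℝ, 1 ≤ x →
      g x = (Real.log ((D : ℝ) * x - Real.sqrt ((D : ℝ) * x ^ 2 - D + 1)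
              + Real.sqrt D * Real.sqrt (((D : ℝ) + 1) * x ^ 2 - D + 1
                  - 2 * x * Real.sqrt ((D : ℝ) * x ^ 2 - D + 1)))
            - Real.log ((D : ℝ) - 1))
          / Real.log ((α : ℝ) + (β : ℝ) * Real.sqrt D) := by
  intro x hx
  have hd : (1 : ℝ) < D := by exact_mod_cast hD
  have hs : 0 < Real.sqrt D := Real.sqrt_pos.mpr (by linarith)
  have hss : Real.sqrt D ^ 2 = D := Real.sq_sqrt (by linarith)
  have hα1 : (1 : ℝ) ≤ α := by exact_mod_cast hα
  have hβ0 : (0 : ℝ) < β := by exact_mod_cast hβ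
  have hsolR : (α : ℝ) ^ 2 - D * (β : ℝ) ^ 2 = 1 := by exact_mod_cast hsol
  have hut := hu (g x) (hg0 x hx)
  have hvt := hv (g x) (hg0 x hx)
  have hxt := hfg x hx
  have ht := hg0 x hx
  have ha : 1 < (α : ℝ) + β * Real.sqrt D := by nlinarith [mul_pos hβ0 hs]
  have hab : ((α : ℝ) + β * Real.sqrt D) * (α - β * Real.sqrt D) = 1 := by
    linear_combination hsolR - (β : ℝ) ^ 2 * hss
  generalize (α : ℝ) + β * Real.sqrt D = a at *
  generalize (α : ℝ) - β * Real.sqrt D = b at *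
  generalize g x = t at *
  have hb : 0 < b := pos_of_mul_pos_right (by rw [hab]; exact one_pos) (by linarith)
  have hA : 1 ≤ a ^ t := Real.one_le_rpow ha.le ht
  have hB : 0 < b ^ t := Real.rpow_pos_of_pos hb t
  have hAB : a ^ t * b ^ t = 1 := by
    rw [← Real.mul_rpow (by linarith) hb.le, hab, Real.one_rpow]
  have hBA : b ^ t ≤ a ^ t := by nlinarith
  have hu0 : 0 ≤ u t := by rw [hut]; positivity
  have hv0 : 0 ≤ v t := by rw [hvt]; exact div_nonneg (by linarith) (by positivity)
  have hsv : Real.sqrt D * v t = (a ^ t - b ^ t) / 2 := by rw [hvt]; field_simp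
  have hconic : u t ^ 2 - D * v t ^ 2 = 1 := by
    have : (D : ℝ) * v t ^ 2 = ((a ^ t - b ^ t) / 2) ^ 2 := by rw [← hsv, mul_pow, hss]
    rw [this, hut]
    linear_combination hAB
  have hsum : u t + Real.sqrt D * v t = a ^ t := by rw [hsv, hut]; ring
  rw [← hxt, pell_conic_log_argument hd.le hu0 hv0 hconic, hsum,
    Real.log_mul (by linarith) (by linarith), add_sub_cancel_left, Real.log_rpow (by linarith),
    mul_div_cancel_right₀ _ (Real.log_pos ha).ne']
end

section
/- For all real x ≥ 0, the following two-sided inequality holds: (2√D/(1 + √D))·(f(x) − 1) < (α + β√D)^x < (2√D/(1 + √D))·f(x), where f = u + v. -/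
theorem stmt9 (D : ℤ) (hD : 1 < D) (hDns : ¬ IsSquare D)
    (α β : ℤ) (hα : 0 < α) (hβ : 0 < β)
    (hsol : α ^ 2 - D * β ^ 2 = 1)
    (hmin : ∀ x y : ℤ, x ^ 2 - D * y ^ 2 = 1 →
      1 < (x : ℝ) + (y : ℝ) * Real.sqrt D →
      (α : ℝ) + (β : ℝ) * Real.sqrt D ≤ (x : ℝ) + (y : ℝ) * Real.sqrt D)
    (u v : ℝ → ℝ)
    (hu : ∀ x : ℝ, 0 ≤ x →
      u x = (((α : ℝ) + (β : ℝ) * Real.sqrt D) ^ x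
        + ((α : ℝ) - (β : ℝ) * Real.sqrt D) ^ x) / 2)
    (hv : ∀ x : ℝ, 0 ≤ x →
      v x = (((α : ℝ) + (β : ℝ) * Real.sqrt D) ^ x
        - ((α : ℝ) - (β : ℝ) * Real.sqrt D) ^ x) / (2 * Real.sqrt D)) :
    ∀ x : ℝ, 0 ≤ x →
      (2 * Real.sqrt D / (1 + Real.sqrt D)) * (u x + v x - 1)
          < ((α : ℝ) + (β : ℝ) * Real.sqrt D) ^ x ∧
      ((α : ℝ) + (β : ℝ) * Real.sqrt D) ^ x
          < (2 * Real.sqrt D / (1 + Real.sqrt D)) * (u x + v x) := by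
  intro x hx
  have hD' : (1 : ℝ) < D := by exact_mod_cast hD
  have hα' : (1 : ℝ) ≤ α := by exact_mod_cast hα
  have hβ' : (0 : ℝ) < β := by exact_mod_cast hβ
  have hsol' : (α : ℝ) ^ 2 - D * (β : ℝ) ^ 2 = 1 := by exact_mod_cast hsol
  rw [hu x hx, hv x hx]
  have hs : 1 < Real.sqrt D := Real.lt_sqrt_of_sq_lt (by simpa using hD')
  have hsq : Real.sqrt D ^ 2 = D := Real.sq_sqrt (by linarith)
  generalize Real.sqrt D = s at hs hsq ⊢
  have hβs : 0 < (β : ℝ) * s := by positivity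
  have hmul : ((α : ℝ) - β * s) * (α + β * s) = 1 := by
    rw [← hsol', ← hsq]; ring
  have hpos : 0 < (α : ℝ) - β * s :=
    pos_of_mul_pos_left (by rw [hmul]; exact one_pos) (by linarith)
  have hle : (α : ℝ) - β * s ≤ 1 := by nlinarith
  have hB₀ := Real.rpow_pos_of_pos hpos x
  have hB₁ := Real.rpow_le_one hpos.le hle hx
  generalize ((α : ℝ) - β * s) ^ x = B at hB₀ hB₁ ⊢
  generalize ((α : ℝ) + β * s) ^ x = A
  have hs₀ : 0 < s := by linarith
  have hs₁ : 0 < 1 + s := by linarith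
  have key : 2 * s / (1 + s) * ((A + B) / 2 + (A - B) / (2 * s))
      = A + B * (s - 1) / (1 + s) := by
    field_simp
    ring
  have hlt : B * (s - 1) / (1 + s) < 2 * s / (1 + s) := by
    have hnum : B * (s - 1) < 2 * s := by nlinarith
    gcongr
  have hgt : 0 < B * (s - 1) / (1 + s) := div_pos (mul_pos hB₀ (by linarith)) hs₁
  rw [mul_sub, key]
  constructor <;> linarith
end

section
/- For any real number x ≥ 1, ⌊g(x)⌋ = ⌊ (log(⌊x⌋) + C) / log(α + β√D) ⌋, where C = log(2√D/(1 + √D)) is a positive real constant, ⌊·⌋ denotes the floor function, and g is the inverse of f = u + v. -/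
/-- Powers of conjugate elements of `ℤ[√D]` are conjugate. -/
lemma exists_int_pow_conj (D α β : ℤ) (s : ℝ) (hs : s ^ 2 = D) (n : ℕ) :
    ∃ a b : ℤ, ((α : ℝ) + β * s) ^ n = a + b * s ∧ ((α : ℝ) - β * s) ^ n = a - b * s := by
  induction n with
  | zero => exact ⟨1, 0, by simp, by simp⟩
  | succ n ih =>
    obtain ⟨a, b, h₁, h₂⟩ := ih
    refine ⟨a * α + b * β * D, a * β + b * α, ?_, ?_⟩
    · rw [pow_succ, h₁]
      push_cast
      linear_combination (b * β : ℝ) * hs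
    · rw [pow_succ, h₂]
      push_cast
      linear_combination (b * β : ℝ) * hs

/-- For `1 / 2 < K < 1`, the map `t ↦ K * t + (1 - K) * t⁻¹` is strictly increasing on `[1, ∞)`. -/
lemma strictMonoOn_mul_add_mul_inv {K : ℝ} (hK : 1 / 2 < K) (hK1 : K < 1) :
    StrictMonoOn (fun t : ℝ => K * t + (1 - K) * t⁻¹) (Set.Ici 1) := by
  intro t ht r _ htr
  have ht1 : (1 : ℝ) ≤ t := ht
  have hr1 : 1 < r := ht1.trans_lt htr
  have ht0 : 0 < t := by linarith
  have hr0 : 0 < r := by linarith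
  have htr1 : 1 < t * r := by nlinarith
  have key : (K * r + (1 - K) * r⁻¹) - (K * t + (1 - K) * t⁻¹)
      = (r - t) * (K * (t * r) - (1 - K)) / (t * r) := by
    field_simp
    ring
  have hpos : 0 < (r - t) * (K * (t * r) - (1 - K)) / (t * r) :=
    div_pos (mul_pos (by linarith) (by nlinarith)) (by linarith)
  change K * t + (1 - K) * t⁻¹ < K * r + (1 - K) * r⁻¹
  linarith


theorem stmt10 (D : ℤ) (hD : 1 < D) (hDns : ¬ IsSquare D)
    (α β : ℤ) (hα : 0 < α) (hβ : 0 < β)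
    (hsol : α ^ 2 - D * β ^ 2 = 1)
    (hmin : ∀ x y : ℤ, x ^ 2 - D * y ^ 2 = 1 →
      1 < (x : ℝ) + (y : ℝ) * Real.sqrt D →
      (α : ℝ) + (β : ℝ) * Real.sqrt D ≤ (x : ℝ) + (y : ℝ) * Real.sqrt D)
    (u v : ℝ → ℝ)
    (hu : ∀ x : ℝ, 0 ≤ x →
      u x = (((α : ℝ) + (β : ℝ) * Real.sqrt D) ^ x
        + ((α : ℝ) - (β : ℝ) * Real.sqrt D) ^ x) / 2)
    (hv : ∀ x : ℝ, 0 ≤ x →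
      v x = (((α : ℝ) + (β : ℝ) * Real.sqrt D) ^ x
        - ((α : ℝ) - (β : ℝ) * Real.sqrt D) ^ x) / (2 * Real.sqrt D))
    (g : ℝ → ℝ)
    (hg0 : ∀ y : ℝ, 1 ≤ y → 0 ≤ g y)
    (hgf : ∀ x : ℝ, 0 ≤ x → g (u x + v x) = x)
    (hfg : ∀ y : ℝ, 1 ≤ y → u (g y) + v (g y) = y) :
    ∀ x : ℝ, 1 ≤ x →
      ⌊g x⌋ = ⌊(Real.log ((⌊x⌋ : ℝ)) + Real.log (2 * Real.sqrt D / (1 + Real.sqrt D)))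
        / Real.log ((α : ℝ) + (β : ℝ) * Real.sqrt D)⌋ := by
  intro x hx
  set s : ℝ := Real.sqrt D with hs_def
  have hDR : (1 : ℝ) < D := by exact_mod_cast hD
  have hs2 : s ^ 2 = D := Real.sq_sqrt (by linarith)
  have hs1 : 1 < s := by
    rw [hs_def, Real.lt_sqrt (by norm_num)]
    linarith
  have hs0 : 0 < s := by linarith
  have hαR : (1 : ℝ) ≤ α := by exact_mod_cast hα
  have hβR : (1 : ℝ) ≤ β := by exact_mod_cast hβ
  have hpell : (α : ℝ) ^ 2 - D * β ^ 2 = 1 := by exact_mod_cast hsol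
  have hconj : ((α : ℝ) + β * s) * (α - β * s) = 1 := by
    linear_combination hpell - (β : ℝ) ^ 2 * hs2
  obtain ⟨ε, hε⟩ : ∃ ε : ℝ, ε = α + β * s := ⟨_, rfl⟩
  have hε1 : 1 < ε := by
    rw [hε]
    nlinarith
  have hε0 : 0 < ε := by linarith
  have hε' : (α : ℝ) - β * s = ε⁻¹ := by
    rw [← hε] at hconj
    exact eq_inv_of_mul_eq_one_right hconj
  obtain ⟨K, hK⟩ : ∃ K : ℝ, K = (1 + s) / (2 * s) := ⟨_, rfl⟩
  have hK0 : 0 < K := by rw [hK]; positivity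
  have hK2 : 1 / 2 < K := by
    rw [hK, div_lt_div_iff₀ (by norm_num) (by positivity)]
    linarith
  have hK1 : K < 1 := by
    rw [hK, div_lt_one (by positivity)]
    linarith
  have hf : ∀ y : ℝ, 0 ≤ y → u y + v y = K * ε ^ y + (1 - K) * (ε ^ y)⁻¹ := by
    intro y hy
    rw [hu y hy, hv y hy, hε', ← hε, Real.inv_rpow hε0.le, hK]
    field_simp
    ring
  have hmono : ∀ y z : ℝ, 0 ≤ y → 0 ≤ z → y ≤ z → u y + v y ≤ u z + v z := by
    intro y z hy hz hyz
    rw [hf y hy, hf z hz]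
    exact (strictMonoOn_mul_add_mul_inv hK2 hK1).monotoneOn
      (Real.one_le_rpow hε1.le hy) (Real.one_le_rpow hε1.le hz)
      (Real.rpow_le_rpow_of_exponent_le hε1.le hyz)
  have hstrict : ∀ y z : ℝ, 0 ≤ y → 0 ≤ z → y < z → u y + v y < u z + v z := by
    intro y z hy hz hyz
    rw [hf y hy, hf z hz]
    exact strictMonoOn_mul_add_mul_inv hK2 hK1
      (Real.one_le_rpow hε1.le hy) (Real.one_le_rpow hε1.le hz)
      (Real.rpow_lt_rpow_of_exponent_lt hε1 hyz)
  have hint : ∀ n : ℕ, ∃ k : ℤ, u n + v n = k := by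
    intro n
    obtain ⟨a, b, h₁, h₂⟩ := exists_int_pow_conj D α β s hs2 n
    refine ⟨a + b, ?_⟩
    rw [hu n n.cast_nonneg, hv n n.cast_nonneg, Real.rpow_natCast, Real.rpow_natCast, h₁, h₂]
    push_cast
    field_simp
    ring
  have hg := hg0 x hx
  obtain ⟨n, hn⟩ : ∃ n : ℕ, ⌊g x⌋ = n := Int.eq_ofNat_of_zero_le (Int.floor_nonneg.mpr hg)
  have hn' := Int.floor_eq_iff.mp hn
  push_cast at hn'
  obtain ⟨k, hk⟩ := hint n
  obtain ⟨l, hl⟩ := hint (n + 1)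
  have hkm : k ≤ ⌊x⌋ := by
    rw [Int.le_floor, ← hk, ← hfg x hx]
    exact hmono _ _ n.cast_nonneg hg hn'.1
  have hml : ⌊x⌋ < l := by
    rw [Int.floor_lt, ← hl, ← hfg x hx]
    refine hstrict _ _ hg (Nat.cast_nonneg _) ?_
    push_cast
    exact hn'.2
  have hm1 : (1 : ℤ) ≤ ⌊x⌋ := by
    rw [Int.le_floor]
    exact_mod_cast hx
  have hm0 : (0 : ℝ) < (⌊x⌋ : ℝ) := by exact_mod_cast hm1
  have hkm' : (k : ℝ) ≤ (⌊x⌋ : ℝ) := by exact_mod_cast hkm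
  have hml' : (⌊x⌋ : ℝ) + 1 ≤ l := by exact_mod_cast hml
  rw [hf _ (Nat.cast_nonneg _), Real.rpow_natCast] at hk hl
  have hlow : K * ε ^ n ≤ (⌊x⌋ : ℝ) := by
    have : 0 ≤ (1 - K) * (ε ^ n)⁻¹ := mul_nonneg (by linarith) (by positivity)
    linarith
  have hup : (⌊x⌋ : ℝ) < K * ε ^ (n + 1) := by
    have : (ε ^ (n + 1))⁻¹ ≤ 1 := inv_le_one_of_one_le₀ (one_le_pow₀ hε1.le)
    have : (1 - K) * (ε ^ (n + 1))⁻¹ ≤ (1 - K) * 1 :=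
      mul_le_mul_of_nonneg_left this (by linarith)
    linarith
  have hlogε : 0 < Real.log ε := Real.log_pos hε1
  have hKinv : 2 * s / (1 + s) = K⁻¹ := by rw [hK, inv_div]
  rw [hn, ← hε, hKinv, Real.log_inv, eq_comm, Int.floor_eq_iff]
  have hlow' := Real.log_le_log (by positivity) hlow
  have hup' := Real.log_lt_log hm0 hup
  rw [Real.log_mul hK0.ne' (by positivity), Real.log_pow] at hlow' hup'
  push_cast at hup' ⊢
  constructor
  · rw [le_div_iff₀ hlogε]
    linarith
  · rw [div_lt_iff₀ hlogε]
    linarith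
end

section
/- Define μ : [1,∞) → ℝ by μ(x) = g(x) − ⌊ (log(⌊x⌋) + C) / log(α + β√D) ⌋, where C = log(2√D/(1 + √D)). Then 0 ≤ μ(x) < 1 for all x ≥ 1, and μ(x) = 0 if and only if x = f(n) for some integer n ≥ 0. -/
/-- The natural powers of `a + b s` and `a - b s` are `p + q s` and `p - q s` with the same
integers `p`, `q`, when `s ^ 2` is an integer. -/
lemma exists_int_pow_add_mul_pow_sub_mul (D a b : ℤ) (s : ℝ) (hs : s ^ 2 = D) (n : ℕ) :
    ∃ p q : ℤ, ((a : ℝ) + b * s) ^ n = p + q * s ∧ ((a : ℝ) - b * s) ^ n = p - q * s := by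
  induction n with
  | zero => exact ⟨1, 0, by simp, by simp⟩
  | succ n ih =>
    obtain ⟨p, q, h₁, h₂⟩ := ih
    refine ⟨p * a + q * b * D, p * b + q * a, ?_, ?_⟩
    · rw [pow_succ, h₁]
      push_cast
      rw [← hs]
      ring
    · rw [pow_succ, h₂]
      push_cast
      rw [← hs]
      ring

/-- A combination `a ε ^ x + b ε⁻¹ ^ x` with `0 ≤ b < a` and `1 < ε` is strictly increasing on
the nonnegative reals. -/
lemma strictMonoOn_mul_rpow_add_mul_inv_rpow {ε a b : ℝ} (hε : 1 < ε) (hb : 0 ≤ b)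
    (hab : b < a) :
    StrictMonoOn (fun x : ℝ => a * ε ^ x + b * ε⁻¹ ^ x) (Set.Ici 0) := by
  intro x hx y _ hxy
  have hX : 1 ≤ ε ^ x := Real.one_le_rpow hε.le hx
  have hXY : ε ^ x < ε ^ y := Real.rpow_lt_rpow_of_exponent_lt hε hxy
  simp only [Real.inv_rpow (zero_le_one.trans hε.le)]
  set X := ε ^ x
  set Y := ε ^ y
  have hX0 : 0 < X := by linarith
  have hY0 : 0 < Y := by linarith
  have hinv : X⁻¹ - Y⁻¹ ≤ Y - X := by
    rw [inv_sub_inv hX0.ne' hY0.ne']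
    exact div_le_self (by linarith) (by nlinarith)
  nlinarith [mul_le_mul_of_nonneg_left hinv hb, mul_pos (sub_pos.2 hab) (sub_pos.2 hXY)]

/-- Two reals with the same natural numbers below them have the same floor, if one of them is
nonnegative. -/
lemma floor_eq_floor_of_forall_natCast_le_iff {a b : ℝ} (ha : 0 ≤ a)
    (h : ∀ n : ℕ, (n : ℝ) ≤ a ↔ (n : ℝ) ≤ b) : ⌊a⌋ = ⌊b⌋ := by
  have hb : 0 ≤ b := by simpa using (h 0).1 (by simpa using ha)
  rw [← Int.natCast_floor_eq_floor ha, ← Int.natCast_floor_eq_floor hb, Nat.cast_inj]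
  apply le_antisymm
  · exact Nat.le_floor ((h _).1 (Nat.floor_le ha))
  · exact Nat.le_floor ((h _).2 (Nat.floor_le hb))

theorem stmt11 (D : ℤ) (hD : 1 < D) (hDns : ¬ IsSquare D)
    (α β : ℤ) (hα : 0 < α) (hβ : 0 < β)
    (hsol : α ^ 2 - D * β ^ 2 = 1)
    (hmin : ∀ x y : ℤ, x ^ 2 - D * y ^ 2 = 1 →
      1 < (x : ℝ) + (y : ℝ) * Real.sqrt D →
      (α : ℝ) + (β : ℝ) * Real.sqrt D ≤ (x : ℝ) + (y : ℝ) * Real.sqrt D)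
    (u v : ℝ → ℝ)
    (hu : ∀ x : ℝ, 0 ≤ x →
      u x = (((α : ℝ) + (β : ℝ) * Real.sqrt D) ^ x
        + ((α : ℝ) - (β : ℝ) * Real.sqrt D) ^ x) / 2)
    (hv : ∀ x : ℝ, 0 ≤ x →
      v x = (((α : ℝ) + (β : ℝ) * Real.sqrt D) ^ x
        - ((α : ℝ) - (β : ℝ) * Real.sqrt D) ^ x) / (2 * Real.sqrt D))
    (g : ℝ → ℝ)
    (hg0 : ∀ y : ℝ, 1 ≤ y → 0 ≤ g y)
    (hgf : ∀ x : ℝ, 0 ≤ x → g (u x + v x) = x)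
    (hfg : ∀ y : ℝ, 1 ≤ y → u (g y) + v (g y) = y)
    (μ : ℝ → ℝ)
    (hμ : ∀ x : ℝ, 1 ≤ x →
      μ x = g x - ⌊(Real.log ((⌊x⌋ : ℝ)) + Real.log (2 * Real.sqrt D / (1 + Real.sqrt D)))
        / Real.log ((α : ℝ) + (β : ℝ) * Real.sqrt D)⌋) :
    ∀ x : ℝ, 1 ≤ x →
      (0 ≤ μ x ∧ μ x < 1) ∧
      (μ x = 0 ↔ ∃ n : ℕ, x = u n + v n) := by
  have hDr : (1 : ℝ) < D := by exact_mod_cast hD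
  set s : ℝ := Real.sqrt D with hs_def
  have hs2 : s ^ 2 = D := Real.sq_sqrt (by linarith)
  have hs : 1 < s := Real.lt_sqrt_of_sq_lt (by simpa using hDr)
  have hα1 : (1 : ℝ) ≤ α := by exact_mod_cast hα
  have hβ1 : (1 : ℝ) ≤ β := by exact_mod_cast hβ
  have hε : 1 < (α : ℝ) + β * s := by nlinarith
  have hsol' : (α : ℝ) ^ 2 - D * β ^ 2 = 1 := by exact_mod_cast hsol
  have hinv : (α : ℝ) - β * s = ((α : ℝ) + β * s)⁻¹ := by
    apply eq_inv_of_mul_eq_one_left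
    rw [← hsol', ← hs2]
    ring
  have hpow := exists_int_pow_add_mul_pow_sub_mul D α β s hs2
  rw [hinv] at hu hv hpow
  set ε : ℝ := (α : ℝ) + β * s
  have hf : ∀ x : ℝ, 0 ≤ x →
      u x + v x = (s + 1) / (2 * s) * ε ^ x + (s - 1) / (2 * s) * ε⁻¹ ^ x := by
    intro x hx
    rw [hu x hx, hv x hx]
    field_simp
    ring
  have hmono : StrictMonoOn (fun x => u x + v x) (Set.Ici 0) :=
    (strictMonoOn_mul_rpow_add_mul_inv_rpow hε (b := (s - 1) / (2 * s))
      (a := (s + 1) / (2 * s)) (div_nonneg (by linarith) (by linarith))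
      (div_lt_div_of_pos_right (by linarith) (by linarith))).congr
      fun x hx => (hf x hx).symm
  intro x hx
  have hg := hg0 x hx
  have hfloor : 0 < ((⌊x⌋ : ℤ) : ℝ) := by
    exact_mod_cast Int.floor_pos.2 hx
  have key : ∀ n : ℕ, (n : ℝ) ≤ g x ↔
      (n : ℝ) ≤ (Real.log (⌊x⌋ : ℝ) + Real.log (2 * s / (1 + s))) / Real.log ε := by
    intro n
    have hK : 0 < 2 * s / (1 + s) := by positivity
    obtain ⟨p, q, h₁, h₂⟩ := hpow n
    have hn := hf n n.cast_nonneg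
    rw [Real.rpow_natCast, Real.rpow_natCast] at hn
    have hpq : u n + v n = ((p + q : ℤ) : ℝ) := by
      rw [hn, h₁, h₂]
      push_cast
      field_simp
      ring
    have hsmall₀ : 0 ≤ (s - 1) / (2 * s) * ε⁻¹ ^ n :=
      mul_nonneg (div_nonneg (by linarith) (by linarith)) (by positivity)
    have hsmall₁ : (s - 1) / (2 * s) * ε⁻¹ ^ n < 1 := by
      refine mul_lt_one_of_nonneg_of_lt_one_left (div_nonneg (by linarith) (by linarith)) ?_ ?_
      · rw [div_lt_one (by linarith)]
        linarith
      · exact pow_le_one₀ (by positivity) (inv_le_one_of_one_le₀ hε.le)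
    rw [← hmono.le_iff_le (Set.mem_Ici.2 n.cast_nonneg) (Set.mem_Ici.2 hg)]
    rw [hfg x hx, hpq, ← Int.le_floor, le_div_iff₀ (Real.log_pos hε),
      ← Real.log_mul hfloor.ne' hK.ne', ← Real.log_pow,
      Real.log_le_log_iff (by positivity) (by positivity), ← div_le_iff₀ hK]
    have hdiv : ε ^ n / (2 * s / (1 + s)) = (s + 1) / (2 * s) * ε ^ n := by
      field_simp
      ring
    rw [hdiv]
    constructor
    · intro h
      have : ((p + q : ℤ) : ℝ) ≤ ⌊x⌋ := Int.cast_le.2 h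
      linarith
    · intro h
      have : ((p + q : ℤ) : ℝ) < (⌊x⌋ + 1 : ℤ) := by
        push_cast at hpq ⊢
        linarith
      exact Int.lt_add_one_iff.1 (Int.cast_lt.1 this)
  have hμx : μ x = Int.fract (g x) := by
    rw [hμ x hx, ← floor_eq_floor_of_forall_natCast_le_iff hg key, Int.self_sub_floor]
  rw [hμx]
  refine ⟨⟨Int.fract_nonneg _, Int.fract_lt_one _⟩, fun h => ?_, ?_⟩
  · refine ⟨⌊g x⌋₊, ?_⟩
    have hgx : ((⌊g x⌋₊ : ℕ) : ℝ) = g x := by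
      rw [natCast_floor_eq_intCast_floor hg]
      linarith [Int.self_sub_floor (g x)]
    rw [hgx, hfg x hx]
  · rintro ⟨n, rfl⟩
    rw [hgf n n.cast_nonneg, Int.fract_natCast]
end

section
/- For any real number λ ≥ 1, the number of integer solutions (x, y) of x² − D·y² = 1 with |x| + |y| ≤ λ equals 2 + 4·⌊ (log(⌊λ⌋) + C) / log(α + β√D) ⌋, where C = log(2√D/(1 + √D)); and there are no such solutions when 0 < λ < 1. -/
open Pell

namespace PellCount

/-- The solution `(x, y)` of the Pell equation minimizing `x + y * √D` among those exceeding `1`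
is fundamental. -/
theorem isFundamental_of_minimal {D α β : ℤ} (hD : 1 < D) (hα : 0 < α) (hβ : 0 < β)
    (hsol : α ^ 2 - D * β ^ 2 = 1)
    (hmin : ∀ x y : ℤ, x ^ 2 - D * y ^ 2 = 1 →
      1 < (x : ℝ) + (y : ℝ) * Real.sqrt D →
      (α : ℝ) + (β : ℝ) * Real.sqrt D ≤ (x : ℝ) + (y : ℝ) * Real.sqrt D) :
    IsFundamental (Solution₁.mk α β hsol) := by
  have hs : 0 < Real.sqrt D := Real.sqrt_pos.2 (by exact_mod_cast (by lia : 0 < D))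
  refine ⟨?_, hβ, fun {b} hb => ?_⟩
  · rw [Solution₁.x_mk]
    nlinarith [mul_pos (zero_lt_one.trans hD) (pow_pos hβ 2)]
  · rw [Solution₁.x_mk]
    by_contra! hlt
    have hb' : b.x ^ 2 - D * |b.y| ^ 2 = 1 := by rw [sq_abs]; exact b.prop
    have hy : |b.y| ≤ β := by
      refine abs_le_of_sq_le_sq ?_ hβ.le
      have : D * b.y ^ 2 ≤ D * β ^ 2 := by nlinarith [b.prop]
      exact le_of_mul_le_mul_left this (by lia)
    have hbR : (1 : ℝ) < b.x := by exact_mod_cast hb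
    have hltR : (b.x : ℝ) < α := by exact_mod_cast hlt
    have hyR : ((|b.y| : ℤ) : ℝ) ≤ β := by exact_mod_cast hy
    have hy0 : (0 : ℝ) ≤ ((|b.y| : ℤ) : ℝ) := by exact_mod_cast abs_nonneg b.y
    have := hmin b.x |b.y| hb' (by nlinarith [mul_nonneg hy0 hs.le])
    nlinarith [mul_le_mul_of_nonneg_right hyR hs.le]

theorem pow_x_add_pow_y_mul_sqrt {D : ℤ} (hD : 0 ≤ D) (a : Solution₁ D) (n : ℕ) :
    ((a ^ n).x : ℝ) + (a ^ n).y * Real.sqrt D = (a.x + a.y * Real.sqrt D) ^ n := by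
  have hs : Real.sqrt D * Real.sqrt D = D := Real.mul_self_sqrt (by exact_mod_cast hD)
  induction n with
  | zero => simp
  | succ n ih =>
    rw [pow_succ, pow_succ, ← ih, Solution₁.x_mul, Solution₁.y_mul]
    push_cast
    linear_combination (-((a ^ n).y * a.y : ℝ)) * hs

theorem one_lt_x_add_y_mul_sqrt {D : ℤ} {a : Solution₁ D} (h : IsFundamental a) :
    (1 : ℝ) < a.x + a.y * Real.sqrt D := by
  have h1 : (1 : ℝ) < a.x := by exact_mod_cast h.1
  have h2 : (0 : ℝ) < a.y := by exact_mod_cast h.2.1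
  nlinarith [mul_nonneg h2.le (Real.sqrt_nonneg D)]

/-- The size `x + y` of a positive solution is at most `m` exactly when its dominant part
`(x + y√D) (1 + √D) / (2√D)` is. -/
theorem x_add_y_le_iff {D : ℤ} (hD : 1 < D) {b : Solution₁ D} (hx : 0 < b.x) (hy : 0 ≤ b.y)
    {m : ℤ} :
    b.x + b.y ≤ m ↔
      (b.x + b.y * Real.sqrt D : ℝ) ≤ m * (2 * Real.sqrt D / (1 + Real.sqrt D)) := by
  set s := Real.sqrt D with hs
  have hs1 : 1 < s := by
    rw [hs, Real.lt_sqrt zero_le_one]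
    exact_mod_cast (by lia : (1 : ℤ) ^ 2 < D)
  have hss : s * s = D := Real.mul_self_sqrt (by exact_mod_cast (by lia : 0 ≤ D))
  have hprod : ((b.x : ℝ) + b.y * s) * (b.x - b.y * s) = 1 := by
    have : (b.x : ℝ) ^ 2 - D * (b.y : ℝ) ^ 2 = 1 := by exact_mod_cast b.prop
    rw [← this, ← hss]
    ring
  have hxR : (1 : ℝ) ≤ b.x := by exact_mod_cast hx
  have hyR : (0 : ℝ) ≤ b.y := by exact_mod_cast hy
  have hsum : (1 : ℝ) ≤ b.x + b.y * s := by nlinarith [mul_nonneg hyR (by linarith : 0 ≤ s)]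
  have hpos : (0 : ℝ) < b.x - b.y * s := by
    by_contra! h
    nlinarith
  have hle : (b.x : ℝ) - b.y * s ≤ 1 := by nlinarith
  rw [← mul_div_assoc, le_div_iff₀ (by linarith)]
  constructor
  · intro h
    have hR : (b.x + b.y : ℝ) ≤ m := by exact_mod_cast h
    nlinarith [mul_pos hpos (sub_pos.2 hs1)]
  · intro h
    have hlt : (b.x + b.y : ℝ) < m + 1 := by
      have h1 : ((b.x : ℝ) - b.y * s) * (s - 1) ≤ 1 * (s - 1) :=
        mul_le_mul_of_nonneg_right hle (by linarith)
      have h2 : 2 * s * (b.x + b.y : ℝ) < 2 * s * (m + 1) := by nlinarith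
      exact lt_of_mul_lt_mul_left h2 (by linarith)
    exact Int.lt_add_one_iff.1 (by exact_mod_cast hlt)

theorem pow_le_mul_iff_le_floor {ε c m : ℝ} (hε : 1 < ε) (hc : 0 < c) (hm : 0 < m) (n : ℕ) :
    ε ^ n ≤ m * c ↔ (n : ℤ) ≤ ⌊(Real.log m + Real.log c) / Real.log ε⌋ := by
  rw [Int.le_floor, le_div_iff₀ (Real.log_pos hε), ← Real.log_mul hm.ne' hc.ne', Int.cast_natCast,
    ← Real.log_pow, Real.log_le_log_iff (by positivity) (by positivity)]

theorem abs_zpow_x_add_abs_zpow_y {D : ℤ} {a : Solution₁ D} (hx : 0 < a.x) (hy : 0 < a.y) (n : ℤ) :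
    |(a ^ n).x| + |(a ^ n).y| = (a ^ n.natAbs).x + (a ^ n.natAbs).y := by
  have key (k : ℕ) : |(a ^ k).x| = (a ^ k).x ∧ |(a ^ k).y| = (a ^ k).y := by
    refine ⟨abs_of_pos (Solution₁.x_pow_pos hx k), abs_of_nonneg ?_⟩
    cases k with
    | zero => simp
    | succ k => exact (Solution₁.y_pow_succ_pos hx hy k).le
  obtain ⟨k, rfl | rfl⟩ := n.eq_nat_or_neg
  · simp [key]
  · simp [key]

/-- The solution `± a ^ n` as a pair of integers, with the sign encoded by a Boolean. -/
def signedZpow {D : ℤ} (a : Solution₁ D) (p : Bool × ℤ) : ℤ × ℤ :=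
  if p.1 then ((a ^ p.2).x, (a ^ p.2).y) else (-(a ^ p.2).x, -(a ^ p.2).y)

theorem signedZpow_injective {D : ℤ} {a : Solution₁ D} (h : IsFundamental a) :
    Function.Injective (signedZpow a) := by
  have hpos := Solution₁.x_zpow_pos h.x_pos
  rintro ⟨b, n⟩ ⟨b', n'⟩ hbn
  have hx := hpos n
  have hx' := hpos n'
  have hinj : (a ^ n).y = (a ^ n').y → n = n' := fun hy => h.y_strictMono.injective hy
  cases b <;> cases b' <;> simp [signedZpow] at hbn
  · simp [hinj hbn.2]
  · lia
  · lia
  · simp [hinj hbn.2]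

theorem setOf_abs_add_abs_le_eq_image {D : ℤ} (hD : 1 < D) {a : Solution₁ D} (h : IsFundamental a)
    {m : ℤ} (hm : 1 ≤ m) :
    {p : ℤ × ℤ | p.1 ^ 2 - D * p.2 ^ 2 = 1 ∧ |p.1| + |p.2| ≤ m} =
      ((Finset.univ ×ˢ Finset.Icc
        (-⌊(Real.log m + Real.log (2 * Real.sqrt D / (1 + Real.sqrt D)))
            / Real.log (a.x + a.y * Real.sqrt D)⌋)
        ⌊(Real.log m + Real.log (2 * Real.sqrt D / (1 + Real.sqrt D)))
            / Real.log (a.x + a.y * Real.sqrt D)⌋).image (signedZpow a) : Finset (ℤ × ℤ)) := by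
  have hs : 0 < Real.sqrt D := Real.sqrt_pos.2 (by exact_mod_cast (by lia : 0 < D))
  set N := ⌊(Real.log m + Real.log (2 * Real.sqrt D / (1 + Real.sqrt D)))
            / Real.log (a.x + a.y * Real.sqrt D)⌋ with hN
  have size (n : ℤ) : |(a ^ n).x| + |(a ^ n).y| ≤ m ↔ -N ≤ n ∧ n ≤ N := by
    have hy : 0 ≤ (a ^ n.natAbs).y := by
      cases n.natAbs with
      | zero => simp
      | succ k => exact (Solution₁.y_pow_succ_pos h.x_pos h.2.1 k).le
    rw [abs_zpow_x_add_abs_zpow_y h.x_pos h.2.1,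
      x_add_y_le_iff hD (Solution₁.x_pow_pos h.x_pos _) hy,
      pow_x_add_pow_y_mul_sqrt (by lia),
      pow_le_mul_iff_le_floor (one_lt_x_add_y_mul_sqrt h) (by positivity)
        (by exact_mod_cast (by lia : 0 < m)), ← hN]
    lia
  ext ⟨x, y⟩
  simp only [Set.mem_ofPred_eq, Finset.coe_image, Set.mem_image, Finset.mem_coe, Finset.mem_product,
    Finset.mem_univ, true_and, Finset.mem_Icc, Prod.exists, ← size]
  constructor
  · rintro ⟨hxy, hle⟩
    obtain ⟨n, hn | hn⟩ := h.eq_zpow_or_neg_zpow (Solution₁.mk x y hxy)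
    · have hx := congrArg Solution₁.x hn
      have hy := congrArg Solution₁.y hn
      simp only [Solution₁.x_mk, Solution₁.y_mk] at hx hy
      exact ⟨true, n, by rwa [← hx, ← hy], by simp [signedZpow, hx, hy]⟩
    · have hx := congrArg Solution₁.x hn
      have hy := congrArg Solution₁.y hn
      simp only [Solution₁.x_mk, Solution₁.y_mk, Solution₁.x_neg, Solution₁.y_neg] at hx hy
      refine ⟨false, n, ?_, by simp [signedZpow, hx, hy]⟩
      rwa [← abs_neg (a ^ n).x, ← abs_neg (a ^ n).y, ← hx, ← hy]
  · rintro ⟨b, n, hle, hbn⟩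
    have hprop := (a ^ n).prop
    cases b <;> simp only [signedZpow, if_true, Bool.false_eq_true, if_false, Prod.mk.injEq] at hbn <;>
      obtain ⟨rfl, rfl⟩ := hbn
    · simpa using ⟨hprop, hle⟩
    · exact ⟨hprop, hle⟩

theorem zero_le_floor_log_div {D m : ℤ} (hD : 1 < D) (hm : 1 ≤ m) {ε : ℝ} (hε : 1 < ε) :
    0 ≤ ⌊(Real.log m + Real.log (2 * Real.sqrt D / (1 + Real.sqrt D))) / Real.log ε⌋ := by
  have hs1 : 1 < Real.sqrt D := by
    rw [Real.lt_sqrt zero_le_one]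
    exact_mod_cast (by lia : (1 : ℤ) ^ 2 < D)
  refine Int.floor_nonneg.2 (div_nonneg (add_nonneg ?_ ?_) (Real.log_pos hε).le)
  · exact Real.log_nonneg (by exact_mod_cast hm)
  · exact Real.log_nonneg (by rw [le_div_iff₀ (by linarith)]; linarith)

theorem abs_cast_add_abs_cast_le_iff {x y : ℤ} {r : ℝ} :
    |(x : ℝ)| + |(y : ℝ)| ≤ r ↔ |x| + |y| ≤ ⌊r⌋ := by
  rw [Int.le_floor]
  push_cast
  rfl

end PellCount

open PellCount in

theorem stmt12 (D : ℤ) (hD : 1 < D) (hDns : ¬ IsSquare D)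
    (α β : ℤ) (hα : 0 < α) (hβ : 0 < β)
    (hsol : α ^ 2 - D * β ^ 2 = 1)
    (hmin : ∀ x y : ℤ, x ^ 2 - D * y ^ 2 = 1 →
      1 < (x : ℝ) + (y : ℝ) * Real.sqrt D →
      (α : ℝ) + (β : ℝ) * Real.sqrt D ≤ (x : ℝ) + (y : ℝ) * Real.sqrt D) :
    (∀ lam : ℝ, 1 ≤ lam →
      ({p : ℤ × ℤ | p.1 ^ 2 - D * p.2 ^ 2 = 1 ∧ |(p.1 : ℝ)| + |(p.2 : ℝ)| ≤ lam}).Finite ∧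
      (({p : ℤ × ℤ | p.1 ^ 2 - D * p.2 ^ 2 = 1 ∧ |(p.1 : ℝ)| + |(p.2 : ℝ)| ≤ lam}).ncard : ℤ)
        = 2 + 4 * ⌊(Real.log ((⌊lam⌋ : ℝ)) + Real.log (2 * Real.sqrt D / (1 + Real.sqrt D)))
            / Real.log ((α : ℝ) + (β : ℝ) * Real.sqrt D)⌋) ∧
    (∀ lam : ℝ, 0 < lam → lam < 1 →
      {p : ℤ × ℤ | p.1 ^ 2 - D * p.2 ^ 2 = 1 ∧ |(p.1 : ℝ)| + |(p.2 : ℝ)| ≤ lam} = ∅) := by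
  have h := isFundamental_of_minimal hD hα hβ hsol hmin
  simp only [abs_cast_add_abs_cast_le_iff]
  refine ⟨fun lam hlam => ?_, fun lam _ hlam => ?_⟩
  · have hm : 1 ≤ ⌊lam⌋ := Int.le_floor.2 (by exact_mod_cast hlam)
    have hN := zero_le_floor_log_div hD hm (one_lt_x_add_y_mul_sqrt h)
    rw [setOf_abs_add_abs_le_eq_image hD h hm]
    refine ⟨Finset.finite_toSet _, ?_⟩
    rw [Set.ncard_coe_finset, Finset.card_image_of_injective _ (signedZpow_injective h),
      Finset.card_product, Int.card_Icc, Finset.card_univ, Fintype.card_bool]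
    simp only [Solution₁.x_mk, Solution₁.y_mk] at hN ⊢
    lia
  · rw [Set.eq_empty_iff_forall_notMem]
    rintro ⟨x, y⟩ ⟨hxy, hle⟩
    have hm : ⌊lam⌋ < 1 := Int.floor_lt.2 (by exact_mod_cast hlam)
    have hx : x = 0 := abs_nonpos_iff.1 (by linarith [abs_nonneg y])
    have hy : y = 0 := abs_nonpos_iff.1 (by linarith [abs_nonneg x])
    simp [hx, hy] at hxy
end

section
/- Let a, b be integers, let i, j ∈ {1, −1}, define f̄_{i,j}(x) := |i·u(x) + a| + |j·v(x) + b| for x ≥ 0 and K := |a| + max{|b| + 1, √(1 + D·b²)}. The set {x ∈ [0,∞) : f̄_{i,j}(x) = K} is nonempty and bounded; let x₁ := sup{x ∈ [0,∞) : f̄_{i,j}(x) = K}. Then f̄_{i,j}(x) ≤ K for every x ∈ [0, x₁]. -/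
/-- The convex function `y ↦ √(1 + D y²) - y` on `[0, B]` is bounded by its endpoint values. -/
lemma pell_chord_bound {D c y B : ℝ} (hD : 0 ≤ D) (hc : c ^ 2 = 1 + D * y ^ 2)
    (hy : 0 ≤ y) (hyB : y ≤ B) :
    c - y + B ≤ max (B + 1) (Real.sqrt (1 + D * B ^ 2)) := by
  rcases hy.eq_or_lt with rfl | hy0
  · refine le_max_of_le_left ?_
    nlinarith
  have hB : 0 < B := hy0.trans_le hyB
  set M := Real.sqrt (1 + D * B ^ 2) with hM
  have hM2 : M ^ 2 = 1 + D * B ^ 2 := Real.sq_sqrt (by positivity)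
  have hM1 : 1 ≤ M := Real.one_le_sqrt.2 (by nlinarith [mul_nonneg hD (sq_nonneg B)])
  have hchord : B * c ≤ y * M + (B - y) := by
    refine le_of_sq_le_sq ?_ (by nlinarith)
    have h : 0 ≤ 2 * y * (B - y) * (M - 1) :=
      mul_nonneg (mul_nonneg (by positivity) (sub_nonneg.2 hyB)) (sub_nonneg.2 hM1)
    have e : (y * M + (B - y)) ^ 2 - (B * c) ^ 2 = 2 * y * (B - y) * (M - 1) := by
      linear_combination y ^ 2 * hM2 - B ^ 2 * hc
    linarith
  have h1 : (B - y) * (B + 1) ≤ (B - y) * max (B + 1) M :=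
    mul_le_mul_of_nonneg_left (le_max_left _ _) (sub_nonneg.2 hyB)
  have h2 : y * M ≤ y * max (B + 1) M := mul_le_mul_of_nonneg_left (le_max_right _ _) hy
  refine le_of_mul_le_mul_left ?_ hB
  nlinarith

/-- Away from the quadrant `c + a ≥ 0`, `y + b ≥ 0`, the taxicab distance from a point `(c, y)` of
the hyperbola `c² = 1 + D y²` to `(-a, -b)` is bounded independently of the point. -/
lemma pell_abs_add_abs_le {D c y : ℝ} (hD : 1 ≤ D) (hc0 : 0 ≤ c) (hc : c ^ 2 = 1 + D * y ^ 2)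
    (hy : 0 ≤ y) (a b : ℝ) (h : c + a < 0 ∨ y + b < 0) :
    |c + a| + |y + b| ≤ |a| + max (|b| + 1) (Real.sqrt (1 + D * b ^ 2)) := by
  have hyc : y ≤ c := by
    refine le_of_sq_le_sq ?_ hc0
    nlinarith [sq_nonneg y]
  have hm := le_max_left (|b| + 1) (Real.sqrt (1 + D * b ^ 2))
  have ha := neg_abs_le a
  have ha' := le_abs_self a
  have hb := neg_abs_le b
  have hb' := le_abs_self b
  rcases lt_or_ge (c + a) 0 with h1 | h1
  · rw [abs_of_neg h1]
    rcases abs_cases (y + b) with ⟨e, -⟩ | ⟨e, -⟩ <;> rw [e] <;> linarith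
  · have h2 := h.resolve_left h1.not_gt
    have hchord := pell_chord_bound (B := -b) (by linarith) hc hy (by linarith)
    rw [neg_sq] at hchord
    rw [abs_of_nonneg h1, abs_of_neg h2, abs_of_neg (show b < 0 by linarith)]
    linarith

lemma pell_distance_level_set {t D : ℝ} (ht : 0 < t) (hD : 1 ≤ D) (a b : ℝ) (f : ℝ → ℝ)
    (hf : ∀ x, f x = |Real.cosh (t * x) + a| + |Real.sinh (t * x) / Real.sqrt D + b|)
    (K : ℝ) (hK : K = |a| + max (|b| + 1) (Real.sqrt (1 + D * b ^ 2)))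
    (S : Set ℝ) (hS : S = {x : ℝ | 0 ≤ x ∧ f x = K}) :
    S.Nonempty ∧ BddAbove S ∧ ∀ x ∈ Set.Icc (0 : ℝ) (sSup S), f x ≤ K := by
  have hs : 0 < Real.sqrt D := Real.sqrt_pos.2 (by linarith)
  have hcont : Continuous f := by
    rw [funext hf]
    fun_prop
  have hf0 : f 0 ≤ K := by
    have h := abs_add_le 1 a
    rw [abs_one] at h
    have := le_max_left (|b| + 1) (Real.sqrt (1 + D * b ^ 2))
    simp only [hf, mul_zero, Real.cosh_zero, Real.sinh_zero, zero_div, zero_add]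
    linarith
  have htop : Filter.Tendsto f Filter.atTop Filter.atTop := by
    refine Filter.tendsto_atTop_mono (f := fun x => t * x + a) (fun x => ?_) ?_
    · have hle : t * x ≤ Real.cosh (t * x) := by
        rcases le_or_gt (t * x) 0 with h | h
        · exact h.trans (Real.cosh_pos _).le
        · exact (Real.self_le_sinh_iff.2 h.le).trans (Real.sinh_lt_cosh _).le
      rw [hf]
      linarith [le_abs_self (Real.cosh (t * x) + a),
        abs_nonneg (Real.sinh (t * x) / Real.sqrt D + b)]
    · exact Filter.tendsto_atTop_add_const_right _ _ (Filter.tendsto_id.const_mul_atTop ht)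
  obtain ⟨R, hR⟩ := (htop.eventually_gt_atTop K).exists_forall_of_atTop
  have hne : S.Nonempty := by
    obtain ⟨x, hx, hxK⟩ := intermediate_value_Icc (le_max_left 0 R) hcont.continuousOn
      ⟨hf0, (hR _ (le_max_right 0 R)).le⟩
    exact ⟨x, hS ▸ ⟨hx.1, hxK⟩⟩
  have hbdd : BddAbove S := by
    refine ⟨R, fun x hx => ?_⟩
    rw [hS] at hx
    by_contra! h
    exact (hR x h.le).ne' hx.2
  have hclosed : IsClosed S := by
    rw [hS]
    exact isClosed_Ici.inter (isClosed_eq hcont continuous_const)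
  refine ⟨hne, hbdd, fun x hx => ?_⟩
  have hfS : f (sSup S) = K := (hS.subset (hclosed.csSup_mem hne hbdd)).2
  have hcosh : Real.cosh (t * x) ≤ Real.cosh (t * sSup S) := by
    rw [Real.cosh_le_cosh, abs_of_nonneg (mul_nonneg ht.le hx.1),
      abs_of_nonneg (mul_nonneg ht.le (hx.1.trans hx.2))]
    exact mul_le_mul_of_nonneg_left hx.2 ht.le
  have hsinh : Real.sinh (t * x) / Real.sqrt D ≤ Real.sinh (t * sSup S) / Real.sqrt D :=
    div_le_div_of_nonneg_right (Real.sinh_le_sinh.2 (mul_le_mul_of_nonneg_left hx.2 ht.le)) hs.le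
  by_cases h : Real.cosh (t * x) + a < 0 ∨ Real.sinh (t * x) / Real.sqrt D + b < 0
  · rw [hf, hK]
    refine pell_abs_add_abs_le hD (Real.cosh_pos _).le ?_
      (div_nonneg (Real.sinh_nonneg_iff.2 (mul_nonneg ht.le hx.1)) hs.le) a b h
    rw [Real.cosh_sq, div_pow, Real.sq_sqrt (by linarith)]
    field_simp
    ring
  · push Not at h
    rw [← hfS, hf, hf, abs_of_nonneg h.1, abs_of_nonneg h.2]
    exact add_le_add ((add_le_add_left hcosh a).trans (le_abs_self _))
      ((add_le_add_left hsinh b).trans (le_abs_self _))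

lemma abs_sign_mul_add {i : ℝ} (hi : i = 1 ∨ i = -1) (c a : ℝ) : |i * c + a| = |c + i * a| := by
  rcases hi with rfl | rfl
  · simp
  · rw [← abs_neg]
    ring_nf


theorem stmt17 (D : ℤ) (hD : 1 < D) (hDns : ¬ IsSquare D)
    (α β : ℤ) (hα : 0 < α) (hβ : 0 < β)
    (hsol : α ^ 2 - D * β ^ 2 = 1)
    (hmin : ∀ x y : ℤ, x ^ 2 - D * y ^ 2 = 1 →
      1 < (x : ℝ) + (y : ℝ) * Real.sqrt D →
      (α : ℝ) + (β : ℝ) * Real.sqrt D ≤ (x : ℝ) + (y : ℝ) * Real.sqrt D)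
    (u v : ℝ → ℝ)
    (hu : ∀ x : ℝ, 0 ≤ x →
      u x = (((α : ℝ) + (β : ℝ) * Real.sqrt D) ^ x
        + ((α : ℝ) - (β : ℝ) * Real.sqrt D) ^ x) / 2)
    (hv : ∀ x : ℝ, 0 ≤ x →
      v x = (((α : ℝ) + (β : ℝ) * Real.sqrt D) ^ x
        - ((α : ℝ) - (β : ℝ) * Real.sqrt D) ^ x) / (2 * Real.sqrt D))
    (a b : ℤ) (i j : ℝ) (hi : i = 1 ∨ i = -1) (hj : j = 1 ∨ j = -1)
    (fbar : ℝ → ℝ)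
    (hfbar : ∀ x : ℝ, 0 ≤ x → fbar x = |i * u x + (a : ℝ)| + |j * v x + (b : ℝ)|)
    (K : ℝ)
    (hK : K = |(a : ℝ)| + max (|(b : ℝ)| + 1) (Real.sqrt (1 + (D : ℝ) * (b : ℝ) ^ 2)))
    (S : Set ℝ) (hS : S = {x : ℝ | 0 ≤ x ∧ fbar x = K}) :
    S.Nonempty ∧ BddAbove S ∧
      ∀ x ∈ Set.Icc (0 : ℝ) (sSup S), fbar x ≤ K := by
  have hDR : (1 : ℝ) < D := by exact_mod_cast hD
  have hαR : (1 : ℝ) ≤ α := by exact_mod_cast hα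
  have hβR : (1 : ℝ) ≤ β := by exact_mod_cast hβ
  have hs : 1 < Real.sqrt D := Real.lt_sqrt_of_sq_lt (by simpa using hDR)
  have hsq : Real.sqrt D ^ 2 = D := Real.sq_sqrt (by linarith)
  have hsolR : (α : ℝ) ^ 2 - D * (β : ℝ) ^ 2 = 1 := by exact_mod_cast hsol
  set e : ℝ := (α : ℝ) + (β : ℝ) * Real.sqrt D with he
  have he1 : 1 < e := by nlinarith
  have hinv : (α : ℝ) - (β : ℝ) * Real.sqrt D = e⁻¹ := by
    refine eq_inv_of_mul_eq_one_left ?_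
    rw [he]
    linear_combination hsolR - (β : ℝ) ^ 2 * hsq
  have hpow (x : ℝ) : e ^ x = Real.exp (Real.log e * x) := Real.rpow_def_of_pos (by linarith) x
  have hpow' (x : ℝ) : e⁻¹ ^ x = Real.exp (-(Real.log e * x)) := by
    rw [Real.inv_rpow (by linarith), hpow, Real.exp_neg]
  have hi1 : |i| = 1 := by rcases hi with rfl | rfl <;> simp
  have hj1 : |j| = 1 := by rcases hj with rfl | rfl <;> simp
  have hj2 : j ^ 2 = 1 := by rw [← sq_abs, hj1, one_pow]
  set g : ℝ → ℝ := fun x => |Real.cosh (Real.log e * x) + i * a|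
    + |Real.sinh (Real.log e * x) / Real.sqrt D + j * b| with hg
  have hfg (x : ℝ) (hx : 0 ≤ x) : fbar x = g x := by
    have hux : u x = Real.cosh (Real.log e * x) := by
      rw [hu x hx, hinv, hpow, hpow', Real.cosh_eq]
    have hvx : v x = Real.sinh (Real.log e * x) / Real.sqrt D := by
      rw [hv x hx, hinv, hpow, hpow', Real.sinh_eq, div_div]
    rw [hfbar x hx, hux, hvx, abs_sign_mul_add hi, abs_sign_mul_add hj]
  obtain ⟨hne, hbdd, hle⟩ := pell_distance_level_set (Real.log_pos he1) hDR.le (i * a) (j * b) g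
    (fun _ => rfl) K (by rw [hK, abs_mul, abs_mul, hi1, hj1, mul_pow, hj2, one_mul, one_mul, one_mul])
    S (by
      rw [hS]
      ext x
      exact and_congr_right fun hx => by rw [hfg x hx])
  exact ⟨hne, hbdd, fun x hx => (hfg x hx.1).trans_le (hle x hx)⟩
end

section
/- Let a, b be integers and K := |a| + max{|b| + 1, √(1 + D·b²)}. Then for any real λ ≥ K, Q_{F_D^{(a,b)}}(λ) = ⋃_{i,j ∈ {1,−1}} {(i·u(n) + a, j·v(n) + b) : n ∈ ℤ, 0 ≤ n ≤ g(λ − i·a − j·b)}, and this set is finite with exactly 2 + Σ_{i,j ∈ {1,−1}} ⌊g(λ − i·a − j·b)⌋ elements, where g is the inverse of f = u + v and ⌊·⌋ denotes the floor function. -/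
/-- The signed lattice points attached to two integer sequences, counted branch by branch. -/
theorem finite_and_ncard_of_mem_iff_signed {X Y : ℕ → ℤ} (hX : ∀ n, 0 < X n)
    (hY : StrictMono Y) (hY0 : Y 0 = 0) (a b : ℤ) (M : ℤ → ℤ → ℕ) {S : Set (ℤ × ℤ)}
    (hS : ∀ p, p ∈ S ↔ ∃ i ∈ ({1, -1} : Set ℤ), ∃ j ∈ ({1, -1} : Set ℤ), ∃ n ≤ M i j,
      p = (i * X n + a, j * Y n + b)) :
    S.Finite ∧ S.ncard = 2 + (M 1 1 + M 1 (-1) + M (-1) 1 + M (-1) (-1)) := by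
  have hYpos : ∀ n, 1 ≤ n → 0 < Y n := fun n hn => hY0 ▸ hY (by omega)
  have hYnonneg : ∀ n, 0 ≤ Y n := fun n => hY0 ▸ hY.monotone n.zero_le
  let branch (i j : ℤ) (k m : ℕ) : Finset (ℤ × ℤ) :=
    (Finset.Icc k m).image fun n => (i * X n + a, j * Y n + b)
  have mem_branch : ∀ i j k m p, p ∈ branch i j k m ↔
      ∃ n, (k ≤ n ∧ n ≤ m) ∧ (i * X n + a, j * Y n + b) = p := by
    intro i j k m p
    simp [branch]
  have card_branch : ∀ i j k m, j ≠ 0 → (branch i j k m).card = m + 1 - k := by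
    intro i j k m hj
    rw [Finset.card_image_of_injective, Nat.card_Icc]
    intro n n' h
    have h2 : j * Y n = j * Y n' := by simpa using congrArg Prod.snd h
    exact hY.injective (mul_left_cancel₀ hj h2)
  have disj_row : ∀ i m m', Disjoint (branch i 1 0 m) (branch i (-1) 1 m') := by
    intro i m m'
    rw [Finset.disjoint_left]
    intro p hp hp'
    obtain ⟨n, -, rfl⟩ := (mem_branch ..).1 hp
    obtain ⟨n', ⟨hn', -⟩, h⟩ := (mem_branch ..).1 hp'
    have h2 := congrArg Prod.snd h
    have := hYpos n' hn'
    have := hYnonneg n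
    simp only at h2
    linarith
  have disj_col : ∀ j j' k k' m m', Disjoint (branch 1 j k m) (branch (-1) j' k' m') := by
    intro j j' k k' m m'
    rw [Finset.disjoint_left]
    intro p hp hp'
    obtain ⟨n, -, rfl⟩ := (mem_branch ..).1 hp
    obtain ⟨n', -, h⟩ := (mem_branch ..).1 hp'
    have h1 := congrArg Prod.fst h
    have := hX n'
    have := hX n
    simp only at h1
    linarith
  have hSeq : S = ((branch 1 1 0 (M 1 1) ∪ branch 1 (-1) 1 (M 1 (-1))) ∪
      (branch (-1) 1 0 (M (-1) 1) ∪ branch (-1) (-1) 1 (M (-1) (-1))) : Finset (ℤ × ℤ)) := by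
    ext p
    rw [hS, Finset.mem_coe]
    simp only [Finset.mem_union, mem_branch]
    constructor
    · rintro ⟨i, rfl | rfl, j, rfl | rfl, n, hn, rfl⟩
      · exact .inl (.inl ⟨n, ⟨n.zero_le, hn⟩, rfl⟩)
      · rcases Nat.eq_zero_or_pos n with rfl | h0
        · exact .inl (.inl ⟨0, ⟨le_rfl, Nat.zero_le _⟩, by simp [hY0]⟩)
        · exact .inl (.inr ⟨n, ⟨h0, hn⟩, rfl⟩)
      · exact .inr (.inl ⟨n, ⟨n.zero_le, hn⟩, rfl⟩)
      · rcases Nat.eq_zero_or_pos n with rfl | h0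
        · exact .inr (.inl ⟨0, ⟨le_rfl, Nat.zero_le _⟩, by simp [hY0]⟩)
        · exact .inr (.inr ⟨n, ⟨h0, hn⟩, rfl⟩)
    · rintro ((⟨n, ⟨-, hn⟩, rfl⟩ | ⟨n, ⟨-, hn⟩, rfl⟩) | ⟨n, ⟨-, hn⟩, rfl⟩ | ⟨n, ⟨-, hn⟩, rfl⟩)
      · exact ⟨1, by simp, 1, by simp, n, hn, rfl⟩
      · exact ⟨1, by simp, -1, by simp, n, hn, rfl⟩
      · exact ⟨-1, by simp, 1, by simp, n, hn, rfl⟩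
      · exact ⟨-1, by simp, -1, by simp, n, hn, rfl⟩
  constructor
  · rw [hSeq]
    exact Finset.finite_toSet _
  · rw [hSeq, Set.ncard_coe_finset, Finset.card_union_of_disjoint, Finset.card_union_of_disjoint
      (disj_row ..), Finset.card_union_of_disjoint (disj_row ..), card_branch _ _ _ _ one_ne_zero,
      card_branch _ _ _ _ (by decide), card_branch _ _ _ _ one_ne_zero,
      card_branch _ _ _ _ (by decide)]
    · omega
    · simp only [Finset.disjoint_union_left, Finset.disjoint_union_right]
      exact ⟨⟨disj_col .., disj_col ..⟩, disj_col .., disj_col ..⟩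

/-- On the hyperbola `X² - D Y² = 1` with `|c| + max (|d| + 1) √(1 + D d²) ≤ l`, the taxicab bound
on the translate by `(c, d)` may be tested without absolute values. -/
theorem abs_add_abs_le_iff_of_hyperbola {D X Y c d l : ℝ} (hD : 1 < D) (hX : 1 ≤ X) (hY : 0 ≤ Y)
    (h : X ^ 2 - D * Y ^ 2 = 1) (hl : |c| + max (|d| + 1) (√(1 + D * d ^ 2)) ≤ l) :
    |X + c| + |Y + d| ≤ l ↔ X + Y ≤ l - c - d := by
  have hYX : Y ≤ X := by nlinarith [mul_nonneg (sub_nonneg.2 hD.le) (sq_nonneg Y)]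
  have hl1 : |c| + (|d| + 1) ≤ l := le_trans (by gcongr; exact le_max_left ..) hl
  have hl2 : |c| + √(1 + D * d ^ 2) ≤ l := le_trans (by gcongr; exact le_max_right ..) hl
  have hc := le_abs_self c
  have hc' := neg_abs_le c
  have hd := le_abs_self d
  have hd' := neg_abs_le d
  constructor
  · intro h
    linarith [le_abs_self (X + c), le_abs_self (Y + d)]
  · intro hle
    rcases abs_cases (X + c) with ⟨e1, h1⟩ | ⟨e1, h1⟩ <;>
      rcases abs_cases (Y + d) with ⟨e2, h2⟩ | ⟨e2, h2⟩ <;> rw [e1, e2]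
    · linarith
    · have hd0 : |d| = -d := abs_of_nonpos (by linarith)
      rcases le_or_gt X (Y + 1) with hX1 | hX1
      · linarith
      · have hY2 : 2 < (D - 1) * Y := by
          have : Y * 2 < Y * ((D - 1) * Y) := by nlinarith
          exact lt_of_mul_lt_mul_left this hY
        have hDY : 4 ≤ (D * Y) * ((D - 1) * Y) := by nlinarith
        have hXD : X ≤ D * Y := by
          refine le_of_sq_le_sq ?_ (by positivity)
          linarith
        set S := √(1 + D * d ^ 2)
        have hSsq : S ^ 2 = 1 + D * d ^ 2 := Real.sq_sqrt (by positivity)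
        have hSD : S ≤ D * -d := by
          refine Real.sqrt_le_iff.2 ⟨by nlinarith, ?_⟩
          have : Y ^ 2 ≤ d ^ 2 := by nlinarith
          nlinarith [mul_le_mul_of_nonneg_left this (by nlinarith : 0 ≤ D * (D - 1))]
        have hS0 : 0 ≤ S := Real.sqrt_nonneg _
        have : -d - Y ≤ S - X := by
          refine le_of_mul_le_mul_right ?_ (by linarith : 0 < S + X)
          nlinarith [mul_nonneg (by linarith : 0 ≤ -d - Y)
            (by linarith : 0 ≤ D * -d + D * Y - (S + X))]
        linarith
    · linarith
    · linarith

/-- The fundamental solution, characterised by minimality of `x + y √D`, is fundamental in the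
sense of `Pell.IsFundamental`. -/
theorem isFundamental_of_minimal {D : ℤ} (hD : 1 < D) {α β : ℤ} (hα : 0 < α) (hβ : 0 < β)
    (hsol : α ^ 2 - D * β ^ 2 = 1)
    (hmin : ∀ x y : ℤ, x ^ 2 - D * y ^ 2 = 1 → 1 < (x : ℝ) + (y : ℝ) * √D →
      (α : ℝ) + (β : ℝ) * √D ≤ (x : ℝ) + (y : ℝ) * √D) :
    Pell.IsFundamental (Pell.Solution₁.mk α β hsol) := by
  refine ⟨?_, by simpa using hβ, ?_⟩
  · simp only [Pell.Solution₁.x_mk]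
    nlinarith
  · intro s hs
    have hs' := s.prop
    simp only [Pell.Solution₁.x_mk]
    by_contra! hlt
    have hsqrt : 0 < √(D : ℝ) := Real.sqrt_pos.2 (by exact_mod_cast (by omega : 0 < D))
    have hy : |s.y| < β := by
      refine abs_lt_of_sq_lt_sq ?_ hβ.le
      nlinarith
    have h := hmin s.x |s.y| (by rw [sq_abs]; exact hs') (by
      have : (1 : ℝ) < s.x := by exact_mod_cast hs
      have : (0 : ℝ) ≤ (|s.y| : ℤ) * √D := by positivity
      linarith)
    have h1 : (s.x : ℝ) < α := by exact_mod_cast hlt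
    have h2 : ((|s.y| : ℤ) : ℝ) < β := by exact_mod_cast hy
    nlinarith

/-- Powers of a Pell solution in terms of real exponentials. -/
theorem pell_pow_add_sub {D : ℤ} (hD : 0 ≤ D) (s : Pell.Solution₁ D) (n : ℕ) :
    ((s ^ n).x : ℝ) + (s ^ n).y * √D = ((s.x : ℝ) + s.y * √D) ^ n ∧
      ((s ^ n).x : ℝ) - (s ^ n).y * √D = ((s.x : ℝ) - s.y * √D) ^ n := by
  have hsq : √(D : ℝ) * √D = D := Real.mul_self_sqrt (by exact_mod_cast hD)
  induction n with
  | zero => simp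
  | succ n ih =>
    rw [pow_succ, pow_succ, pow_succ, ← ih.1, ← ih.2, Pell.Solution₁.x_mul, Pell.Solution₁.y_mul]
    push_cast
    constructor <;> linear_combination (-((s ^ n).y : ℝ) * s.y) * hsq

theorem strictMonoOn_rpow_combination {P Q r : ℝ} (hP : 1 < P) (hPQ : P * Q = 1) (hr : 1 ≤ r) :
    StrictMonoOn (fun x : ℝ => (P ^ x + Q ^ x) / 2 + (P ^ x - Q ^ x) / (2 * r)) (Set.Ici 0) := by
  intro s hs t _ hst
  have hQ : Q = P⁻¹ := eq_inv_of_mul_eq_one_right hPQ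
  have hp : 1 ≤ P ^ s := Real.one_le_rpow hP.le hs
  have hpq : P ^ s < P ^ t := Real.rpow_lt_rpow_of_exponent_lt hP hst
  have hQx : ∀ x : ℝ, Q ^ x = (P ^ x)⁻¹ := fun x => by rw [hQ, Real.inv_rpow (by linarith)]
  simp only [hQx]
  generalize P ^ s = p at *
  generalize P ^ t = q at *
  have hdiff : (q + q⁻¹) / 2 + (q - q⁻¹) / (2 * r) - ((p + p⁻¹) / 2 + (p - p⁻¹) / (2 * r)) =
      (q - p) * ((p * q - 1) * r + (p * q + 1)) / (2 * r * p * q) := by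
    have : p ≠ 0 := by linarith
    have : q ≠ 0 := by linarith
    have : r ≠ 0 := by linarith
    field_simp
    ring
  have : 0 < (q - p) * ((p * q - 1) * r + (p * q + 1)) / (2 * r * p * q) := by
    have h1 : 1 < p * q := by nlinarith
    have : 0 < p * q - 1 := by linarith
    have : 0 < q - p := by linarith
    have : 0 < r := by linarith
    have : 0 < p := by linarith
    have : 0 < q := by linarith
    positivity
  linarith


theorem stmt19 (D : ℤ) (hD : 1 < D) (hDns : ¬ IsSquare D)
    (α β : ℤ) (hα : 0 < α) (hβ : 0 < β)
    (hsol : α ^ 2 - D * β ^ 2 = 1)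
    (hmin : ∀ x y : ℤ, x ^ 2 - D * y ^ 2 = 1 →
      1 < (x : ℝ) + (y : ℝ) * Real.sqrt D →
      (α : ℝ) + (β : ℝ) * Real.sqrt D ≤ (x : ℝ) + (y : ℝ) * Real.sqrt D)
    (u v : ℝ → ℝ)
    (hu : ∀ x : ℝ, 0 ≤ x →
      u x = (((α : ℝ) + (β : ℝ) * Real.sqrt D) ^ x
        + ((α : ℝ) - (β : ℝ) * Real.sqrt D) ^ x) / 2)
    (hv : ∀ x : ℝ, 0 ≤ x →
      v x = (((α : ℝ) + (β : ℝ) * Real.sqrt D) ^ x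
        - ((α : ℝ) - (β : ℝ) * Real.sqrt D) ^ x) / (2 * Real.sqrt D))
    (g : ℝ → ℝ)
    (hg0 : ∀ y : ℝ, 1 ≤ y → 0 ≤ g y)
    (hgf : ∀ x : ℝ, 0 ≤ x → g (u x + v x) = x)
    (hfg : ∀ y : ℝ, 1 ≤ y → u (g y) + v (g y) = y)
    (a b : ℤ)
    (K : ℝ)
    (hK : K = |(a : ℝ)| + max (|(b : ℝ)| + 1) (Real.sqrt (1 + (D : ℝ) * (b : ℝ) ^ 2))) :
    ∀ lam : ℝ, K ≤ lam →
      ({p : ℤ × ℤ | (p.1 - a) ^ 2 - D * (p.2 - b) ^ 2 = 1 ∧ |(p.1 : ℝ)| + |(p.2 : ℝ)| ≤ lam} =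
        ⋃ i ∈ ({1, -1} : Set ℝ), ⋃ j ∈ ({1, -1} : Set ℝ),
          {p : ℤ × ℤ | ∃ n : ℕ, (n : ℝ) ≤ g (lam - i * (a : ℝ) - j * (b : ℝ)) ∧
            (p.1 : ℝ) = i * u n + (a : ℝ) ∧ (p.2 : ℝ) = j * v n + (b : ℝ)}) ∧
      ({p : ℤ × ℤ | (p.1 - a) ^ 2 - D * (p.2 - b) ^ 2 = 1 ∧ |(p.1 : ℝ)| + |(p.2 : ℝ)| ≤ lam}).Finite ∧
      (({p : ℤ × ℤ | (p.1 - a) ^ 2 - D * (p.2 - b) ^ 2 = 1 ∧ |(p.1 : ℝ)| + |(p.2 : ℝ)| ≤ lam}).ncard : ℤ)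
        = 2 + (⌊g (lam - (a : ℝ) - (b : ℝ))⌋ + ⌊g (lam - (a : ℝ) + (b : ℝ))⌋
            + ⌊g (lam + (a : ℝ) - (b : ℝ))⌋ + ⌊g (lam + (a : ℝ) + (b : ℝ))⌋) := by
  set s : Pell.Solution₁ D := Pell.Solution₁.mk α β hsol with hs
  have hfund : Pell.IsFundamental s := isFundamental_of_minimal hD hα hβ hsol hmin
  set X : ℕ → ℤ := fun n => (s ^ n).x
  set Y : ℕ → ℤ := fun n => (s ^ n).y with hYdef
  have hDr : (1 : ℝ) < D := by exact_mod_cast hD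
  have hXpos : ∀ n, 0 < X n := fun n => Pell.Solution₁.x_pow_pos hfund.x_pos n
  have hYmono : StrictMono Y := fun m n hmn => by
    simpa using hfund.y_strictMono (Int.ofNat_lt.2 hmn)
  have hY0 : Y 0 = 0 := by simp [hYdef]
  have hYnonneg : ∀ n, 0 ≤ Y n := fun n => hY0 ▸ hYmono.monotone n.zero_le
  have hXY : ∀ n, X n ^ 2 - D * Y n ^ 2 = 1 := fun n => (s ^ n).prop
  have hsqrt1 : 1 < √(D : ℝ) := Real.lt_sqrt_of_sq_lt (by simpa using hDr)
  have hun : ∀ n : ℕ, u n = X n := by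
    intro n
    obtain ⟨h1, h2⟩ := pell_pow_add_sub (by omega) s n
    simp only [hs, Pell.Solution₁.x_mk, Pell.Solution₁.y_mk] at h1 h2
    rw [hu n n.cast_nonneg, Real.rpow_natCast, Real.rpow_natCast, ← h1, ← h2]
    ring
  have hvn : ∀ n : ℕ, v n = Y n := by
    intro n
    obtain ⟨h1, h2⟩ := pell_pow_add_sub (by omega) s n
    simp only [hs, Pell.Solution₁.x_mk, Pell.Solution₁.y_mk] at h1 h2
    rw [hv n n.cast_nonneg, Real.rpow_natCast, Real.rpow_natCast, ← h1, ← h2]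
    field_simp
    ring
  have hmono : StrictMonoOn (fun x => u x + v x) (Set.Ici 0) := by
    refine (strictMonoOn_rpow_combination (P := α + β * √D) (Q := α - β * √D) (r := √D)
      ?_ ?_ hsqrt1.le).congr fun x hx => ?_
    · have : (1 : ℝ) ≤ α := by exact_mod_cast hα
      have : (0 : ℝ) < β := by exact_mod_cast hβ
      have : 0 < (β : ℝ) * √D := by positivity
      linarith
    · have hsq : √(D : ℝ) * √D = D := Real.mul_self_sqrt (by linarith)
      have : (α : ℝ) ^ 2 - D * β ^ 2 = 1 := by exact_mod_cast hsol
      linear_combination this - (β : ℝ) ^ 2 * hsq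
    · simp only [hu x hx, hv x hx]
  have hle_g : ∀ (n : ℕ) (y : ℝ), 1 ≤ y → ((n : ℝ) ≤ g y ↔ (X n : ℝ) + Y n ≤ y) := by
    intro n y hy
    rw [← hmono.le_iff_le (Set.mem_Ici.2 n.cast_nonneg) (hg0 y hy)]
    simp only [hfg y hy, hun, hvn]
  have hall : ∀ x y : ℤ, x ^ 2 - D * y ^ 2 = 1 → ∃ i ∈ ({1, -1} : Set ℤ),
      ∃ j ∈ ({1, -1} : Set ℤ), ∃ n, x = i * X n ∧ y = j * Y n := by
    intro x y hxy
    have hx0 : x ≠ 0 := by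
      rintro rfl
      nlinarith [sq_nonneg y]
    obtain ⟨n, hn⟩ := hfund.eq_pow_of_nonneg
      (a := Pell.Solution₁.mk |x| |y| (by simpa only [sq_abs] using hxy))
      (by simpa using hx0) (by simp)
    have hx : |x| = X n := by simpa using congrArg Pell.Solution₁.x hn
    have hy : |y| = Y n := by simpa using congrArg Pell.Solution₁.y hn
    have sign : ∀ z w : ℤ, |z| = w → ∃ i ∈ ({1, -1} : Set ℤ), z = i * w := by
      rintro z _ rfl
      rcases abs_choice z with h | h
      · exact ⟨1, by simp, by rw [h, one_mul]⟩
      · exact ⟨-1, by simp, by rw [h]; ring⟩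
    obtain ⟨i, hi, hx⟩ := sign _ _ hx
    obtain ⟨j, hj, hy⟩ := sign _ _ hy
    exact ⟨i, hi, j, hj, n, hx, hy⟩
  intro lam hlam
  rw [hK] at hlam
  have habs : ∀ i ∈ ({1, -1} : Set ℤ), |(i : ℝ)| = 1 := by
    rintro i (rfl | rfl) <;> simp
  have hsq : ∀ i ∈ ({1, -1} : Set ℤ), i * i = 1 := by
    rintro i (rfl | rfl) <;> rfl
  have habs_mul : ∀ i ∈ ({1, -1} : Set ℤ), ∀ c : ℤ, |(i : ℝ) * c| = |(c : ℝ)| :=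
    fun i hi c => by rw [abs_mul, habs i hi, one_mul]
  have hone : ∀ i ∈ ({1, -1} : Set ℤ), ∀ j ∈ ({1, -1} : Set ℤ),
      1 ≤ lam - (i : ℝ) * a - (j : ℝ) * b := by
    intro i hi j hj
    linarith [le_max_left (|(b : ℝ)| + 1) (√(1 + (D : ℝ) * (b : ℝ) ^ 2)),
      (le_abs_self ((i : ℝ) * a)).trans_eq (habs_mul i hi a),
      (le_abs_self ((j : ℝ) * b)).trans_eq (habs_mul j hj b)]
  have hkey : ∀ i ∈ ({1, -1} : Set ℤ), ∀ j ∈ ({1, -1} : Set ℤ), ∀ n : ℕ,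
      (|((i * X n + a : ℤ) : ℝ)| + |((j * Y n + b : ℤ) : ℝ)| ≤ lam ↔
        (n : ℝ) ≤ g (lam - i * a - j * b)) := by
    intro i hi j hj n
    have factor : ∀ i ∈ ({1, -1} : Set ℤ), ∀ z c : ℤ,
        |((i * z + c : ℤ) : ℝ)| = |(z : ℝ) + i * c| := by
      rintro i hi z c
      have : (i : ℝ) * i = 1 := by exact_mod_cast hsq i hi
      rw [← one_mul |(z : ℝ) + i * c|, ← habs i hi, ← abs_mul]
      congr 1
      push_cast
      linear_combination -(c : ℝ) * this
    have hjb2 : ((j : ℝ) * b) ^ 2 = (b : ℝ) ^ 2 := by rw [← sq_abs, habs_mul j hj, sq_abs]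
    rw [factor i hi, factor j hj, hle_g]
    · refine abs_add_abs_le_iff_of_hyperbola hDr (by exact_mod_cast hXpos n)
        (by exact_mod_cast hYnonneg n) (by exact_mod_cast hXY n) ?_
      rwa [habs_mul i hi, habs_mul j hj, hjb2]
    · exact hone i hi j hj
  have hmem : ∀ p : ℤ × ℤ, ((p.1 - a) ^ 2 - D * (p.2 - b) ^ 2 = 1 ∧
      |(p.1 : ℝ)| + |(p.2 : ℝ)| ≤ lam) ↔ ∃ i ∈ ({1, -1} : Set ℤ), ∃ j ∈ ({1, -1} : Set ℤ),
        ∃ n : ℕ, (n : ℝ) ≤ g (lam - i * a - j * b) ∧ p = (i * X n + a, j * Y n + b) := by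
    rintro ⟨x, y⟩
    constructor
    · rintro ⟨hxy, hle⟩
      obtain ⟨i, hi, j, hj, n, hx, hy⟩ := hall _ _ hxy
      obtain rfl : x = i * X n + a := by linarith
      obtain rfl : y = j * Y n + b := by linarith
      exact ⟨i, hi, j, hj, n, (hkey i hi j hj n).1 hle, rfl⟩
    · rintro ⟨i, hi, j, hj, n, hn, hp⟩
      obtain ⟨rfl, rfl⟩ := Prod.mk.inj hp
      refine ⟨?_, (hkey i hi j hj n).2 hn⟩
      linear_combination hXY n + X n ^ 2 * hsq i hi - D * Y n ^ 2 * hsq j hj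
  have hgnonneg : ∀ i ∈ ({1, -1} : Set ℤ), ∀ j ∈ ({1, -1} : Set ℤ),
      0 ≤ g (lam - i * a - j * b) := by
    intro i hi j hj
    exact hg0 _ (hone i hi j hj)
  obtain ⟨hfin, hcard⟩ := finite_and_ncard_of_mem_iff_signed hXpos hYmono hY0 a b
    (fun i j => ⌊g (lam - i * a - j * b)⌋₊)
    (S := {p : ℤ × ℤ | (p.1 - a) ^ 2 - D * (p.2 - b) ^ 2 = 1 ∧ |(p.1 : ℝ)| + |(p.2 : ℝ)| ≤ lam})
    (fun p => by
      rw [Set.mem_ofPred_eq, hmem p]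
      refine exists_congr fun i => and_congr_right fun hi => exists_congr fun j =>
        and_congr_right fun hj => exists_congr fun n => and_congr_left fun _ => ?_
      exact (Nat.le_floor_iff (hgnonneg i hi j hj)).symm)
  refine ⟨?_, hfin, ?_⟩
  · ext p
    rw [Set.mem_ofPred_eq, hmem p]
    simp only [Set.mem_iUnion, Set.mem_ofPred_eq, Set.mem_insert_iff, Set.mem_singleton_iff,
      exists_prop, exists_eq_or_imp, exists_eq_left, hun, hvn]
    simp only [Prod.ext_iff, ← @Int.cast_inj ℝ, Int.cast_one, Int.cast_neg, Int.cast_add,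
      Int.cast_mul]
  · have hfloor : ∀ i ∈ ({1, -1} : Set ℤ), ∀ j ∈ ({1, -1} : Set ℤ),
        (⌊g (lam - i * a - j * b)⌋₊ : ℤ) = ⌊g (lam - i * a - j * b)⌋ :=
      fun i hi j hj => Int.natCast_floor_eq_floor (hgnonneg i hi j hj)
    rw [hcard]
    simp only [Nat.cast_add, Nat.cast_ofNat]
    rw [hfloor 1 (by simp) 1 (by simp), hfloor 1 (by simp) (-1) (by simp),
      hfloor (-1) (by simp) 1 (by simp), hfloor (-1) (by simp) (-1) (by simp)]
    simp only [Int.cast_one, Int.cast_neg, one_mul, neg_mul, sub_neg_eq_add]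
end
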